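/- arXiv:0802.1739 — 3 statements merged into one kernel-verified Lean document; each statement's English description precedes it below -/
import Mathlib

section
/- For 1 ≤ j ≤ k+1, let f_j be a proper holomorphic map from B_n to B_{N_j}, and assume the functions ‖f_1‖², …, ‖f_{k+1}‖² on B_n are linearly independent over ℝ. For λ ∈ ℝ^k define R_λ(z) = Σ_{j=1}^k λ_j ‖f_j(z)‖² + (1 − Σ_{j=1}^k λ_j)·‖f_{k+1}(z)‖². Let K = {λ ∈ ℝ^k : there exist m ∈ ℕ and a holomorphic map h : B_n → ℂ^m with ‖h(z)‖² = R_λ(z) for all z ∈ B_n}. Then K is compact and convex. -/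
/-- A proper holomorphic map from the ball `B_n` to the ball `B_N`. -/
def IsProperBallMap (n N : ℕ)
    (f : EuclideanSpace ℂ (Fin n) → EuclideanSpace ℂ (Fin N)) : Prop :=
  DifferentiableOn ℂ f (Metric.ball 0 1) ∧
  (∀ z ∈ Metric.ball (0 : EuclideanSpace ℂ (Fin n)) 1, ‖f z‖ < 1) ∧
  (∀ u : ℕ → EuclideanSpace ℂ (Fin n),
    (∀ j, u j ∈ Metric.ball (0 : EuclideanSpace ℂ (Fin n)) 1) →
    Filter.Tendsto (fun j => ‖u j‖) Filter.atTop (nhds 1) →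
    Filter.Tendsto (fun j => ‖f (u j)‖) Filter.atTop (nhds 1))

open scoped ComplexConjugate

/-- Diagonal operator with real entries. -/
noncomputable def diagOp {ι : Type*} [Fintype ι] (d : ι → ℝ) :
    EuclideanSpace ℂ ι →L[ℂ] EuclideanSpace ℂ ι :=
  LinearMap.toContinuousLinearMap
    { toFun := fun x => WithLp.toLp 2 (fun i => (d i : ℂ) * x i)
      map_add' := by intro x y; ext i; simp [mul_add]
      map_smul' := by intro a x; ext i; simp; ring }

lemma diagOp_apply {ι : Type*} [Fintype ι] (d : ι → ℝ) (x : EuclideanSpace ℂ ι) (i : ι) :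
    diagOp d x i = (d i : ℂ) * x i := rfl

lemma inner_diagOp {ι : Type*} [Fintype ι] (d : ι → ℝ) (x : EuclideanSpace ℂ ι) :
    inner ℂ x (diagOp d x) = ((∑ i, d i * ‖x i‖ ^ 2 : ℝ) : ℂ) := by
  rw [PiLp.inner_apply]
  push_cast
  refine Finset.sum_congr rfl fun i _ => ?_
  rw [diagOp_apply, RCLike.inner_apply, mul_assoc, Complex.mul_conj']

lemma inner_diagOp' {ι : Type*} [Fintype ι] (d : ι → ℝ) (x : EuclideanSpace ℂ ι) :
    inner ℂ (diagOp d x) x = ((∑ i, d i * ‖x i‖ ^ 2 : ℝ) : ℂ) := by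
  rw [← inner_conj_symm, inner_diagOp, Complex.conj_ofReal]

lemma inner_self_real {V : Type*} [NormedAddCommGroup V] [InnerProductSpace ℂ V] (x : V) :
    inner ℂ x x = ((‖x‖ ^ 2 : ℝ) : ℂ) := by
  rw [inner_self_eq_norm_sq_to_K]; norm_cast

/-- Positivity on a subspace gives a square root. -/
lemma exists_sqrt {ι : Type*} [Fintype ι] (d : ι → ℝ) (W : Submodule ℂ (EuclideanSpace ℂ ι))
    (hW : ∀ x ∈ W, 0 ≤ ∑ i, d i * ‖x i‖ ^ 2) :
    ∃ S : EuclideanSpace ℂ ι →L[ℂ] EuclideanSpace ℂ ι,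
      ∀ x ∈ W, ‖S x‖ ^ 2 = ∑ i, d i * ‖x i‖ ^ 2 := by
  classical
  set A : EuclideanSpace ℂ ι →L[ℂ] EuclideanSpace ℂ ι :=
    W.starProjection ∘L diagOp d ∘L W.starProjection with hA
  have key : ∀ x, inner ℂ (A x) x = ((∑ i, d i * ‖W.starProjection x i‖ ^ 2 : ℝ) : ℂ) := by
    intro x
    rw [← inner_diagOp', hA]
    exact Submodule.inner_starProjection_left_eq_right _ _ _
  have hpos : A.IsPositive := by
    rw [ContinuousLinearMap.isPositive_iff_complex]
    intro x
    rw [key]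
    exact ⟨rfl, hW _ (W.starProjection_apply_mem x)⟩
  have h0 : 0 ≤ A := (ContinuousLinearMap.nonneg_iff_isPositive A).2 hpos
  obtain ⟨S, hS⟩ := CStarAlgebra.nonneg_iff_eq_star_mul_self.1 h0
  refine ⟨S, fun x hx => ?_⟩
  have h1 : inner ℂ (S x) (S x) = inner ℂ (A x) x := by
    rw [hS, ContinuousLinearMap.star_eq_adjoint]
    exact (ContinuousLinearMap.adjoint_inner_left S x (S x)).symm
  rw [key, Submodule.starProjection_eq_self_iff.2 hx, inner_self_real] at h1
  exact Complex.ofReal_injective h1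

section pol
variable {E : Type*} [NormedAddCommGroup E] [NormedSpace ℂ E]

lemma polar_hol {ι : Type*} [Fintype ι] (g₁ g₂ : E → EuclideanSpace ℂ ι)
    (h₁ : DifferentiableOn ℂ g₁ (Metric.ball 0 1)) (h₂ : DifferentiableOn ℂ g₂ (Metric.ball 0 1))
    (p q : E) (s : ℂ) (hs₁ : p + conj s • q ∈ Metric.ball (0 : E) 1)
    (hs₂ : p + s • q ∈ Metric.ball (0 : E) 1) :
    DifferentiableAt ℂ (fun s : ℂ => inner ℂ (g₁ (p + conj s • q)) (g₂ (p + s • q))) s := by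
  have e : (fun s : ℂ => inner ℂ (g₁ (p + conj s • q)) (g₂ (p + s • q))) =
      fun s : ℂ => ∑ i, g₂ (p + s • q) i * conj (g₁ (p + conj s • q) i) := by
    ext s; rw [PiLp.inner_apply]; rfl
  rw [e]
  have d₁ := h₁.differentiableAt (Metric.isOpen_ball.mem_nhds hs₁)
  have d₂ := h₂.differentiableAt (Metric.isOpen_ball.mem_nhds hs₂)
  refine DifferentiableAt.fun_sum fun i _ => ?_
  refine DifferentiableAt.mul ?_ ?_
  · have a : DifferentiableAt ℂ (fun s : ℂ => g₂ (p + s • q)) s :=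
      DifferentiableAt.comp s (f := fun s : ℂ => p + s • q) d₂ (by fun_prop)
    exact (differentiableAt_euclidean.1 a) i
  · have a : DifferentiableAt ℂ (fun s : ℂ => g₁ (p + s • q)) (conj s) :=
      DifferentiableAt.comp (conj s) (f := fun s : ℂ => p + s • q) d₁ (by fun_prop)
    have b := (differentiableAt_euclidean.1 a) i
    have := b.star_star
    simpa [Function.comp_def] using this

lemma polarization {ι κ : Type*} [Fintype ι] [Fintype κ] (F : E → EuclideanSpace ℂ ι)
    (h : E → EuclideanSpace ℂ κ) (D : EuclideanSpace ℂ ι →L[ℂ] EuclideanSpace ℂ ι)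
    (hF : DifferentiableOn ℂ F (Metric.ball 0 1)) (hh : DifferentiableOn ℂ h (Metric.ball 0 1))
    (heq : ∀ z ∈ Metric.ball (0 : E) 1, inner ℂ (h z) (h z) = inner ℂ (F z) (D (F z)))
    (z w : E) (hz : z ∈ Metric.ball (0 : E) 1) (hw : w ∈ Metric.ball (0 : E) 1) :
    inner ℂ (h w) (h z) = inner ℂ (F w) (D (F z)) := by
  set p : E := (1 / 2 : ℂ) • (z + w) with hp
  set q : E := (-Complex.I / 2 : ℂ) • (z - w) with hq
  have ez : p + Complex.I • q = z := by
    rw [hp, hq, smul_smul]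
    have : Complex.I * (-Complex.I / 2) = 1 / 2 := by
      linear_combination (-1 / 2 : ℂ) * Complex.I_mul_I
    rw [this]; module
  have ew : p + conj Complex.I • q = w := by
    rw [hp, hq, smul_smul, Complex.conj_I]
    have : -Complex.I * (-Complex.I / 2) = -(1 / 2) := by
      linear_combination (1 / 2 : ℂ) * Complex.I_mul_I
    rw [this]; module
  set U : Set ℂ := {s | p + conj s • q ∈ Metric.ball (0 : E) 1 ∧
    p + s • q ∈ Metric.ball (0 : E) 1} with hU
  have hUo : IsOpen U := by
    refine IsOpen.inter (Metric.isOpen_ball.preimage ?_) (Metric.isOpen_ball.preimage ?_)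
    · exact continuous_const.add (Complex.continuous_conj.smul continuous_const)
    · fun_prop
  have hUc : Convex ℝ U := by
    have cb : Convex ℝ (Metric.ball (0 : E) 1) := convex_ball _ _
    intro s hs t ht a b ha hb hab
    have hpq : p = a • p + b • p := by rw [← add_smul, hab, one_smul]
    constructor
    · have := cb hs.1 ht.1 ha hb hab
      convert this using 1
      conv_lhs => rw [hpq]
      simp only [map_add, Complex.real_smul, map_mul, Complex.conj_ofReal, add_smul, smul_add,
        mul_smul, Complex.coe_smul]
      abel
    · have := cb hs.2 ht.2 ha hb hab
      convert this using 1
      conv_lhs => rw [hpq]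
      simp only [Complex.real_smul, add_smul, smul_add, mul_smul, Complex.coe_smul]
      abel
  have hI : Complex.I ∈ U := ⟨by rw [ew]; exact hw, by rw [ez]; exact hz⟩
  have h0 : (0 : ℂ) ∈ U := by
    have : p ∈ Metric.ball (0 : E) 1 := by
      have := (convex_ball (0 : E) 1) hz hw (a := 1/2) (b := 1/2) (by norm_num) (by norm_num)
        (by norm_num)
      convert this using 1
      rw [hp, ← smul_add, ← Complex.coe_smul]
      norm_num
    exact ⟨by simpa using this, by simpa using this⟩
  set φ : ℂ → ℂ := fun s => inner ℂ (h (p + conj s • q)) (h (p + s • q)) -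
    inner ℂ (F (p + conj s • q)) (D (F (p + s • q))) with hφ
  have hφd : DifferentiableOn ℂ φ U := fun s hs =>
    ((polar_hol h h hh hh p q s hs.1 hs.2).sub
      (polar_hol F (fun z => D (F z)) hF (D.differentiable.comp_differentiableOn hF)
        p q s hs.1 hs.2)).differentiableWithinAt
  have hφa : AnalyticOnNhd ℂ φ U := hφd.analyticOnNhd hUo
  have hfreq : ∃ᶠ s in nhdsWithin (0 : ℂ) {0}ᶜ, φ s = 0 := by
    have t : Filter.Tendsto (fun t : ℝ => (t : ℂ)) (nhdsWithin 0 {0}ᶜ) (nhdsWithin 0 {0}ᶜ) := by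
      refine tendsto_nhdsWithin_iff.2 ⟨?_, ?_⟩
      · have := Complex.continuous_ofReal.tendsto 0
        rw [Complex.ofReal_zero] at this
        exact this.mono_left nhdsWithin_le_nhds
      · filter_upwards [self_mem_nhdsWithin] with x hx
        simpa using hx
    refine t.frequently (Filter.Eventually.frequently ?_)
    have hmem : ∀ᶠ x : ℝ in nhdsWithin 0 {0}ᶜ, (x : ℂ) ∈ U :=
      t.eventually (nhdsWithin_le_nhds (hUo.mem_nhds h0))
    filter_upwards [hmem] with x hx
    simp only [hφ, Complex.conj_ofReal]
    rw [heq _ hx.2, sub_self]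
  have := hφa.eqOn_zero_of_preconnected_of_frequently_eq_zero hUc.isPreconnected h0 hfreq hI
  simp only [hφ, ez, ew, Pi.zero_apply] at this
  exact sub_eq_zero.1 this

/-- Characterisation by positivity on the span. -/
lemma sqnorm_iff {ι : Type*} [Fintype ι] (F : E → EuclideanSpace ℂ ι)
    (hF : DifferentiableOn ℂ F (Metric.ball 0 1)) (d : ι → ℝ) :
    (∃ (m : ℕ) (h : E → EuclideanSpace ℂ (Fin m)), DifferentiableOn ℂ h (Metric.ball 0 1) ∧
      ∀ z ∈ Metric.ball (0 : E) 1, ‖h z‖ ^ 2 = ∑ i, d i * ‖F z i‖ ^ 2) ↔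
    ∀ x ∈ Submodule.span ℂ (Set.image F (Metric.ball (0 : E) 1)), 0 ≤ ∑ i, d i * ‖x i‖ ^ 2 := by
  constructor
  · rintro ⟨m, h, hh, heq⟩ x hx
    have pol := polarization F h (diagOp d) hF hh (fun z hz => by
      rw [inner_diagOp, ← heq z hz, inner_self_real])
    obtain ⟨r, a, g, rfl⟩ := Submodule.mem_span_set'.1 hx
    choose z hz hzg using fun i => (g i).2
    have e : inner ℂ (∑ i, a i • h (z i)) (∑ i, a i • h (z i)) =
        inner ℂ (∑ i, a i • (g i : EuclideanSpace ℂ ι))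
          (diagOp d (∑ i, a i • (g i : EuclideanSpace ℂ ι))) := by
      simp only [← hzg, map_sum, map_smul, sum_inner, inner_sum, inner_smul_left,
        inner_smul_right, pol _ _ (hz _) (hz _)]
    rw [inner_diagOp, inner_self_real] at e
    have e' : ‖∑ i, a i • h (z i)‖ ^ 2 =
      ∑ i, d i * ‖(∑ j, a j • (g j : EuclideanSpace ℂ ι)) i‖ ^ 2 := 
        Complex.ofReal_injective e
    rw [← e']; positivity
  · intro hpos
    obtain ⟨S, hS⟩ := exists_sqrt d _ hpos
    let b := (stdOrthonormalBasis ℂ (EuclideanSpace ℂ ι)).repr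
    refine ⟨_, fun z => b (S (F z)), ?_, fun z hz => ?_⟩
    · exact b.toContinuousLinearEquiv.differentiable.comp_differentiableOn
        (S.differentiable.comp_differentiableOn hF)
    · rw [b.norm_map]
      exact hS _ (Submodule.subset_span ⟨z, hz, rfl⟩)
end pol

/-- A holomorphic map tending to zero at the boundary vanishes. -/
lemma vanish {E V : Type*} [NormedAddCommGroup E] [NormedSpace ℂ E] [Nontrivial E]
    [NormedAddCommGroup V] [NormedSpace ℂ V]
    (g : E → V) (hg : DifferentiableOn ℂ g (Metric.ball 0 1))
    (hb : ∀ u : ℕ → E, (∀ j, u j ∈ Metric.ball (0 : E) 1) →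
      Filter.Tendsto (fun j => ‖u j‖) Filter.atTop (nhds 1) →
      Filter.Tendsto (fun j => ‖g (u j)‖ ^ 2) Filter.atTop (nhds 0))
    (z : E) (hz : z ∈ Metric.ball (0 : E) 1) : ‖g z‖ ^ 2 = 0 := by
  have hz1 : ‖z‖ < 1 := by simpa using hz
  suffices h : ‖g z‖ ≤ 0 by
    have := le_antisymm h (norm_nonneg _)
    rw [this]; norm_num
  refine le_of_forall_pos_le_add fun ε hε => ?_
  rw [zero_add]
  obtain ⟨r, hr1, hr⟩ : ∃ r < (1 : ℝ), ∀ w ∈ Metric.ball (0 : E) 1, r < ‖w‖ → ‖g w‖ ≤ ε := by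
    by_contra! hc
    have : ∀ j : ℕ, (1 - 1 / ((j : ℝ) + 1)) < 1 := fun j => by
      have : 0 < 1 / ((j : ℝ) + 1) := by positivity
      linarith
    choose u hu hur huε using fun j : ℕ => hc _ (this j)
    have t1 : Filter.Tendsto (fun j => ‖u j‖) Filter.atTop (nhds 1) := by
      refine tendsto_of_tendsto_of_tendsto_of_le_of_le (g := fun j : ℕ => 1 - 1 / ((j : ℝ) + 1))
        (h := fun _ => 1) ?_ tendsto_const_nhds (fun j => (hur j).le)
        (fun j => by have := hu j; simp at this; exact this.le)
      simpa using tendsto_const_nhds.sub (tendsto_one_div_add_atTop_nhds_zero_nat (𝕜 := ℝ))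
    have := ge_of_tendsto' (hb u hu t1) (fun j => pow_le_pow_left₀ hε.le (huε j).le 2)
    have : 0 < ε ^ 2 := by positivity
    linarith
  obtain ⟨s, hs, hs1⟩ := exists_between (max_lt (max_lt hr1 hz1) one_pos)
  have hrs : r < s := ((le_max_left _ _).trans (le_max_left _ _)).trans_lt hs
  have hzs : ‖z‖ < s := ((le_max_right _ _).trans (le_max_left _ _)).trans_lt hs
  have hs0 : 0 < s := (le_max_right _ _).trans_lt hs
  refine Complex.norm_le_of_forall_mem_frontier_norm_le (U := Metric.ball (0 : E) s) (f := g)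
    Metric.isBounded_ball ?_ ?_ (subset_closure (by simpa using hzs))
  · refine DifferentiableOn.diffContOnCl (hg.mono ?_)
    exact Metric.closure_ball_subset_closedBall.trans (Metric.closedBall_subset_ball hs1)
  · intro w hw
    have : ‖w‖ = s := by simpa using Metric.frontier_ball_subset_sphere hw
    exact hr w (by simpa [this] using hs1) (by rw [this]; exact hrs)

/-- The coefficient vector. -/
noncomputable def coef {k : ℕ} (t : ℝ) (v : Fin k → ℝ) : Fin (k + 1) → ℝ :=
  Fin.snoc (α := fun _ => ℝ) v (t - ∑ j, v j)

lemma coef_sum {k : ℕ} (t : ℝ) (v : Fin k → ℝ) (a : Fin (k + 1) → ℝ) :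
    ∑ j, coef t v j * a j = (∑ j : Fin k, v j * a j.castSucc) + (t - ∑ j, v j) * a (Fin.last k) := by
  simp [Fin.sum_univ_castSucc, coef]

lemma coef_combo {k : ℕ} (t s a b : ℝ) (v w : Fin k → ℝ) (j : Fin (k + 1)) :
    coef (a * t + b * s) (a • v + b • w) j = a * coef t v j + b * coef s w j := by
  refine Fin.lastCases ?_ (fun i => ?_) j
  · simp [coef, Finset.sum_add_distrib, ← Finset.mul_sum]; ring
  · simp [coef]

lemma coef_continuous {k : ℕ} (j : Fin (k + 1)) :
    Continuous (fun p : ℝ × (Fin k → ℝ) => coef p.1 p.2 j) := by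
  refine Fin.lastCases ?_ (fun i => ?_) j
  · simp only [coef, Fin.snoc_last]; fun_prop
  · simp only [coef, Fin.snoc_castSucc]; fun_prop

/-- The set of parameters `λ ∈ ℝ^k` for which the affine combination
`R_λ = Σ λ_j ‖f_j‖² + (1 - Σ λ_j)‖f_{k+1}‖²` of squared norms of proper maps
between balls is the squared norm of a holomorphic map is compact and convex. -/
theorem parameter_set_compact_convex
    (n k : ℕ) (N : Fin (k + 1) → ℕ)
    (f : (j : Fin (k + 1)) → EuclideanSpace ℂ (Fin n) → EuclideanSpace ℂ (Fin (N j)))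
    (hf : ∀ j, IsProperBallMap n (N j) (f j))
    (hindep : LinearIndependent ℝ (fun j : Fin (k + 1) =>
      (Metric.ball (0 : EuclideanSpace ℂ (Fin n)) 1).restrict
        (fun z => ‖f j z‖ ^ 2)))
    (R : (Fin k → ℝ) → EuclideanSpace ℂ (Fin n) → ℝ)
    (hR : ∀ lam z, R lam z =
      (∑ j : Fin k, lam j * ‖f j.castSucc z‖ ^ 2) +
        (1 - ∑ j : Fin k, lam j) * ‖f (Fin.last k) z‖ ^ 2)
    (K : Set (Fin k → ℝ))
    (hK : K = {lam : Fin k → ℝ | ∃ (m : ℕ)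
      (h : EuclideanSpace ℂ (Fin n) → EuclideanSpace ℂ (Fin m)),
      DifferentiableOn ℂ h (Metric.ball 0 1) ∧
      ∀ z ∈ Metric.ball (0 : EuclideanSpace ℂ (Fin n)) 1,
        ‖h z‖ ^ 2 = R lam z}) :
    IsCompact K ∧ Convex ℝ K := by
  classical
  let F : EuclideanSpace ℂ (Fin n) → EuclideanSpace ℂ (Σ j, Fin (N j)) :=
    fun z => WithLp.toLp 2 (fun s => f s.1 z s.2)
  have hF : DifferentiableOn ℂ F (Metric.ball 0 1) := by
    rw [differentiableOn_euclidean]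
    intro s
    exact (differentiableOn_euclidean.1 (hf s.1).1) s.2
  let W := Submodule.span ℂ (Set.image F (Metric.ball (0 : EuclideanSpace ℂ (Fin n)) 1))
  let C : Set (ℝ × (Fin k → ℝ)) :=
    {p | ∀ x ∈ W, 0 ≤ ∑ s : (Σ j, Fin (N j)), coef p.1 p.2 s.1 * ‖x s‖ ^ 2}
  have hsum : ∀ t v z, ∑ s : (Σ j, Fin (N j)), coef t v s.1 * ‖F z s‖ ^ 2 =
      ∑ j, coef t v j * ‖f j z‖ ^ 2 := by
    intro t v z
    rw [Fintype.sum_sigma]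
    refine Finset.sum_congr rfl fun j _ => ?_
    rw [EuclideanSpace.norm_sq_eq, Finset.mul_sum]
  have hchar : ∀ t v, (∃ (m : ℕ) (h : EuclideanSpace ℂ (Fin n) → EuclideanSpace ℂ (Fin m)),
      DifferentiableOn ℂ h (Metric.ball 0 1) ∧
      ∀ z ∈ Metric.ball (0 : EuclideanSpace ℂ (Fin n)) 1,
        ‖h z‖ ^ 2 = ∑ j, coef t v j * ‖f j z‖ ^ 2) ↔ (t, v) ∈ C := by
    intro t v
    have := sqnorm_iff F hF (fun s => coef t v s.1)
    simp only [hsum] at this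
    exact this
  have hKC : ∀ v, v ∈ K ↔ ((1 : ℝ), v) ∈ C := by
    intro v
    rw [← hchar, hK]
    simp only [Set.mem_setOf_eq, hR, coef_sum]
  have hcombo : ∀ t s v w a b, (t, v) ∈ C → (s, w) ∈ C → 0 ≤ a → 0 ≤ b →
      (a * t + b * s, a • v + b • w) ∈ C := by
    intro t s v w a b h₁ h₂ ha hb x hx
    have e : ∑ i : (Σ j, Fin (N j)), coef (a * t + b * s) (a • v + b • w) i.1 * ‖x i‖ ^ 2 =
        a * ∑ i : (Σ j, Fin (N j)), coef t v i.1 * ‖x i‖ ^ 2 +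
        b * ∑ i : (Σ j, Fin (N j)), coef s w i.1 * ‖x i‖ ^ 2 := by
      rw [Finset.mul_sum, Finset.mul_sum, ← Finset.sum_add_distrib]
      refine Finset.sum_congr rfl fun i _ => ?_
      rw [coef_combo]; ring
    change 0 ≤ ∑ i : (Σ j, Fin (N j)), coef (a * t + b * s) (a • v + b • w) i.1 * ‖x i‖ ^ 2
    rw [e]
    exact add_nonneg (mul_nonneg ha (h₁ x hx)) (mul_nonneg hb (h₂ x hx))
  have hCclosed : IsClosed C := by
    have : C = ⋂ x ∈ W, {p | 0 ≤ ∑ s : (Σ j, Fin (N j)), coef p.1 p.2 s.1 * ‖x s‖ ^ 2} := by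
      ext p; simp [C]
    rw [this]
    refine isClosed_biInter fun x _ => isClosed_le continuous_const ?_
    exact continuous_finset_sum _ fun s _ => (coef_continuous s.1).mul continuous_const
  have hzero : ∀ v, ((0 : ℝ), v) ∈ C → v = 0 := by
    intro v hv
    have hc : (∀ z ∈ Metric.ball (0 : EuclideanSpace ℂ (Fin n)) 1,
        ∑ j, coef 0 v j * ‖f j z‖ ^ 2 = 0) → v = 0 := by
      intro h0
      have := Fintype.linearIndependent_iff.1 hindep (coef 0 v) (by
        ext ⟨z, hz⟩
        simp only [Finset.sum_apply, Pi.smul_apply, smul_eq_mul, Pi.zero_apply]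
        exact h0 z hz)
      ext j
      simpa [coef] using this j.castSucc
    rcases Nat.eq_zero_or_pos n with hn | hn
    · subst hn
      have h1 : k + 1 ≤ 1 := by
        have : Subsingleton (Metric.ball (0 : EuclideanSpace ℂ (Fin 0)) 1) := inferInstance
        have e := hindep.fintype_card_le_finrank
        have hle : Fintype.card (Metric.ball (0 : EuclideanSpace ℂ (Fin 0)) 1) ≤ 1 :=
          Fintype.card_le_one_iff_subsingleton.2 this
        rw [Module.finrank_fintype_fun_eq_card, Fintype.card_fin] at e
        omega
      have : k = 0 := by omega
      subst this
      exact Subsingleton.elim _ _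
    · have : Nonempty (Fin n) := ⟨⟨0, hn⟩⟩
      apply hc
      obtain ⟨m, h, hh, heq⟩ := (hchar 0 v).2 hv
      intro z hz
      rw [← heq z hz]
      refine vanish h hh (fun u hu hu1 => ?_) z hz
      have e : (fun j => ‖h (u j)‖ ^ 2) = fun i => ∑ j, coef 0 v j * ‖f j (u i)‖ ^ 2 := by
        ext i; exact heq _ (hu i)
      rw [e]
      have t : Filter.Tendsto (fun i => ∑ j, coef 0 v j * ‖f j (u i)‖ ^ 2) Filter.atTop
          (nhds (∑ j, coef 0 v j * 1 ^ 2)) :=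
        tendsto_finset_sum _ fun j _ => (((hf j).2.2 u hu hu1).pow 2).const_mul _
      have z0 : ∑ j, coef 0 v j * (1 : ℝ) ^ 2 = 0 := by
        rw [coef_sum 0 v (fun _ => (1 : ℝ) ^ 2)]; simp
      rwa [z0] at t
  refine ⟨?_, ?_⟩
  · refine Metric.isCompact_of_isClosed_isBounded ?_ ?_
    · have : K = Set.preimage (fun v : Fin k → ℝ => ((1 : ℝ), v)) C := by
        ext v; exact hKC v
      rw [this]
      exact hCclosed.preimage (by fun_prop)
    · by_contra hb
      have hb' : ∀ i : ℕ, ∃ v ∈ K, (i : ℝ) + 1 < ‖v‖ := by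
        intro i
        by_contra! hc
        exact hb (isBounded_iff_forall_norm_le.2 ⟨_, hc⟩)
      choose v hvK hv using hb'
      have hpos : ∀ i, 0 < ‖v i‖ := fun i => lt_trans (by positivity) (hv i)
      have hsph : ∀ i, ‖v i‖⁻¹ • v i ∈ Metric.sphere (0 : Fin k → ℝ) 1 := by
        intro i
        have := (hpos i).ne'
        simp [norm_smul, this]
      obtain ⟨w, hw, ψ, hψ, hlim⟩ := (isCompact_sphere (0 : Fin k → ℝ) 1).tendsto_subseq hsph
      have hinv : Filter.Tendsto (fun i => ‖v i‖⁻¹) Filter.atTop (nhds 0) := by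
        refine Filter.Tendsto.comp tendsto_inv_atTop_zero ?_
        refine Filter.tendsto_atTop_mono (fun i => ?_) tendsto_natCast_atTop_atTop
        have := hv i
        linarith
      have hmem : ∀ i, (‖v i‖⁻¹, ‖v i‖⁻¹ • v i) ∈ C := by
        intro i
        have h1 := (hKC _).1 (hvK i)
        have := hcombo _ _ _ _ ‖v i‖⁻¹ 0 h1 h1 (inv_nonneg.2 (norm_nonneg _)) le_rfl
        simpa using this
      have hwC : ((0 : ℝ), w) ∈ C :=
        hCclosed.mem_of_tendsto ((hinv.comp hψ.tendsto_atTop).prodMk_nhds hlim)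
          (Filter.Eventually.of_forall fun i => hmem (ψ i))
      have := hzero w hwC
      rw [this] at hw
      simp at hw
  · intro v hv w hw a b ha hb hab
    rw [hKC] at *
    have := hcombo _ _ _ _ a b hv hw ha hb
    simpa [hab] using this
end

section
/- Let g : ℂ^n → ℂ^N be a polynomial map with g(0) = 0 and ‖g(z)‖ < 1 for all z in the closed unit ball of ℂ^n. Then there exist an integer K and a polynomial map p : ℂ^n → ℂ^K with p(0) = 0 such that ‖g(z)‖² + ‖p(z)‖² = 1 for all z with ‖z‖ = 1; that is, the map g ⊕ p = (g, p) : ℂ^n → ℂ^{N+K} maps the unit sphere of ℂ^n into the unit sphere of ℂ^{N+K} and restricts to a proper polynomial map from B_n to B_{N+K}. -/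
open MvPolynomial

theorem rep_aux {E : Type*} [CommRing E] [Algebra ℝ E] (T : Set E)
    (hadd : ∀ a ∈ T, ∀ b ∈ T, a + b ∈ T) (hmul : ∀ a ∈ T, ∀ b ∈ T, a * b ∈ T)
    (hsm : ∀ r : ℝ, 0 ≤ r → ∀ a ∈ T, r • a ∈ T) (h1 : (1 : E) ∈ T)
    (hneg : (-1 : E) ∉ T) (harch : ∀ a : E, ∃ N : ℝ, N • (1 : E) - a ∈ T)
    (f : E) (hf : f ∉ T) :
    ∃ g : E →ₗ[ℝ] ℝ, (∀ t ∈ T, 0 ≤ g t) ∧ g 1 = 1 ∧ g f ≤ 0 := by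
  have h0 : (0 : E) ∈ T := by simpa using hsm 0 le_rfl 1 h1
  have hne : (1 : E) ≠ 0 := by
    intro h
    apply hneg
    rw [h, neg_zero]; exact h0
  let C : PointedCone ℝ E :=
    { carrier := {x | ∃ r : ℝ, 0 ≤ r ∧ x + r • f ∈ T}
      smul_mem' := by
        rintro ⟨c, hc⟩ x ⟨r, hr, hx⟩
        refine ⟨c * r, by positivity, ?_⟩
        have := hsm c hc _ hx
        rw [smul_add, smul_smul] at this
        exact this
      zero_mem' := ⟨0, le_rfl, by simpa using h0⟩
      add_mem' := by
        rintro x y ⟨r, hr, hx⟩ ⟨s, hs, hy⟩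
        refine ⟨r + s, by positivity, ?_⟩
        have := hadd _ hx _ hy
        rw [add_smul]
        convert this using 1
        abel }
  have hC : ∀ x, x ∈ C ↔ ∃ r : ℝ, 0 ≤ r ∧ x + r • f ∈ T := fun x => Iff.rfl
  have hTC : ∀ t ∈ T, t ∈ C := fun t ht => (hC t).2 ⟨0, le_rfl, by simpa using ht⟩
  have hnegC : (-1 : E) ∉ C := by
    rintro ⟨r, hr, hx⟩
    rcases hr.eq_or_lt with rfl | hr
    · apply hneg; simpa using hx
    · apply hf
      have := hsm r⁻¹ (by positivity) _ (hadd _ hx _ h1)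
      have e : r⁻¹ • (-1 + r • f + 1) = f := by
        rw [show -1 + r • f + 1 = r • f by ring, smul_smul, inv_mul_cancel₀ hr.ne', one_smul]
      rwa [e] at this
  obtain ⟨g, hg1, hg2⟩ := riesz_extension C (LinearPMap.mkSpanSingleton (1 : E) (1 : ℝ) hne)
    (by
      rintro ⟨x, hx⟩ hxC
      obtain ⟨c, rfl⟩ := Submodule.mem_span_singleton.1 hx
      have ev : (LinearPMap.mkSpanSingleton (1 : E) (1 : ℝ) hne : E →ₗ.[ℝ] ℝ) ⟨c • 1, hx⟩ = c := by
        unfold LinearPMap.mkSpanSingleton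
        rw [LinearPMap.mkSpanSingleton'_apply]; simp
      rw [ev]
      by_contra hc
      have hc : c < 0 := by simpa using hc
      apply hnegC
      have := PointedCone.smul_mem C (r := (-c)⁻¹) (by rw [inv_nonneg]; linarith) hxC
      have e : (-c)⁻¹ • c • (1 : E) = -1 := by
        rw [smul_smul, inv_neg, neg_mul, inv_mul_cancel₀ hc.ne, neg_smul, one_smul]
      have this : (-c)⁻¹ • c • (1 : E) ∈ C := this
      rwa [e] at this)
    (by
      intro y
      obtain ⟨N, hN⟩ := harch (-y)
      refine ⟨⟨N • (1 : E), Submodule.mem_span_singleton.2 ⟨N, rfl⟩⟩, ?_⟩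
      apply hTC
      simpa using hN)
  refine ⟨g, fun t ht => hg2 t (hTC t ht), ?_, ?_⟩
  · have := hg1 ⟨1, Submodule.mem_span_singleton_self _⟩
    rw [this]
    exact LinearPMap.mkSpanSingleton_apply ℝ ℝ hne (1 : ℝ)
  · have := hg2 (-f) ((hC _).2 ⟨1, zero_le_one, by simpa using h0⟩)
    rw [map_neg] at this
    linarith

theorem rep_main {E : Type*} [CommRing E] [Algebra ℝ E] (T : Set E)
    (hadd : ∀ a ∈ T, ∀ b ∈ T, a + b ∈ T) (hmul : ∀ a ∈ T, ∀ b ∈ T, a * b ∈ T)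
    (hsm : ∀ r : ℝ, 0 ≤ r → ∀ a ∈ T, r • a ∈ T) (h1 : (1 : E) ∈ T)
    (hneg : (-1 : E) ∉ T) (harch : ∀ a : E, ∃ N : ℝ, N • (1 : E) - a ∈ T)
    (f : E) (hf : f ∉ T) :
    ∃ g : E →ₐ[ℝ] ℝ, (∀ t ∈ T, 0 ≤ g t) ∧ g f ≤ 0 := by
  obtain ⟨g₀, hg₀, hg₀1, hg₀f⟩ := rep_aux T hadd hmul hsm h1 hneg harch f hf
  let K : Set (E → ℝ) := {L | (∀ a b, L (a + b) = L a + L b) ∧ (∀ (r : ℝ) a, L (r • a) = r * L a) ∧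
    (∀ t ∈ T, 0 ≤ L t) ∧ L 1 = 1}
  have hKsub : ∀ L ∈ K, ∀ a b, L (a - b) = L a - L b := by
    rintro L ⟨ha, -, -, -⟩ a b
    have := ha (a - b) b
    rw [sub_add_cancel] at this
    linarith
  choose N hN using harch
  have hKN : ∀ L ∈ K, ∀ a, L a ≤ N a := by
    intro L hL a
    have h := hL.2.2.1 _ (hN a)
    rw [hKsub L hL, hL.2.1, hL.2.2.2] at h
    linarith
  have hKcl : IsClosed K := by
    have e : K = (⋂ a, ⋂ b, {L : E → ℝ | L (a + b) = L a + L b}) ∩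
        ((⋂ r : ℝ, ⋂ a, {L : E → ℝ | L (r • a) = r * L a}) ∩
        ((⋂ t ∈ T, {L : E → ℝ | 0 ≤ L t}) ∩ {L : E → ℝ | L 1 = 1})) := by
      ext L; simp [K]
    rw [e]
    refine IsClosed.inter ?_ (IsClosed.inter ?_ (IsClosed.inter ?_ ?_))
    · exact isClosed_iInter fun a => isClosed_iInter fun b => isClosed_eq (by fun_prop) (by fun_prop)
    · exact isClosed_iInter fun a => isClosed_iInter fun b => isClosed_eq (by fun_prop) (by fun_prop)
    · exact isClosed_iInter fun a => isClosed_iInter fun b => isClosed_le (by fun_prop) (by fun_prop)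
    · exact isClosed_eq (by fun_prop) (by fun_prop)
  have hKc : IsCompact K := by
    refine (isCompact_univ_pi (s := fun a : E => Set.Icc (-N (-a)) (N a))
      fun a => isCompact_Icc).of_isClosed_subset hKcl ?_
    intro L hL a _
    refine ⟨?_, hKN L hL a⟩
    have h := hKN L hL (-a)
    have h2 := hL.2.1 (-1) a
    rw [neg_one_smul] at h2
    linarith
  have hg₀K : (fun a => g₀ a) ∈ K := ⟨by simp, by simp, hg₀, hg₀1⟩
  obtain ⟨L₀, hL₀, hmin⟩ := hKc.exists_isMinOn ⟨_, hg₀K⟩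
    (f := fun L : E → ℝ => L f) (by fun_prop)
  have hmin' : ∀ L ∈ K, L₀ f ≤ L f := fun L hL => hmin hL
  have hm : L₀ f ≤ 0 := (hmin' _ hg₀K).trans hg₀f
  let F : Set (E → ℝ) := K ∩ {L | L f = L₀ f}
  have hFc : IsCompact F := hKc.inter_right (isClosed_eq (by fun_prop) (by fun_prop))
  obtain ⟨L, hLext⟩ := hFc.extremePoints_nonempty ⟨L₀, hL₀, rfl⟩
  obtain ⟨⟨hLK, hLf⟩, hext⟩ := mem_extremePoints.1 hLext
  have hLf : L f = L₀ f := hLf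
  have hsub := hKsub L hLK
  have hN1 := hKN L hLK
  obtain ⟨hLa, hLs, hLp, hL1⟩ := hLK
  have key : ∀ t ∈ T, 1 - t ∈ T → ∀ b, L (t * b) = L t * L b := by
    intro t ht ht1 b
    have hc0 : 0 ≤ L t := hLp t ht
    have hc1 : L t ≤ 1 := by
      have := hLp _ ht1
      rw [hsub, hL1] at this; linarith
    let P : E → ℝ := fun a => L a + (L (t * a) - L t * L a)
    let M : E → ℝ := fun a => L a - (L (t * a) - L t * L a)
    have hP : P ∈ K := by
      refine ⟨fun a b => ?_, fun r a => ?_, fun s hs => ?_, ?_⟩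
      · simp only [P, mul_add, hLa]; ring
      · simp only [P, mul_smul_comm, hLs]; ring
      · have h2 := hLp _ (hmul _ ht _ hs)
        have h3 := hLp _ hs
        simp only [P]
        nlinarith
      · simp [P, hL1]
    have hM : M ∈ K := by
      refine ⟨fun a b => ?_, fun r a => ?_, fun s hs => ?_, ?_⟩
      · simp only [M, mul_add, hLa]; ring
      · simp only [M, mul_smul_comm, hLs]; ring
      · have h2 := hLp _ (hmul _ ht1 _ hs)
        have h3 := hLp _ hs
        rw [sub_mul, one_mul, hsub] at h2
        simp only [M]
        nlinarith
      · simp [M, hL1]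
    have e1 := hmin' P hP
    have e2 := hmin' M hM
    have hPF : P ∈ F := ⟨hP, by
      simp only [P, M] at e1 e2
      show L f + (L (t * f) - L t * L f) = L₀ f
      linarith⟩
    have hMF : M ∈ F := ⟨hM, by
      simp only [P, M] at e1 e2
      show L f - (L (t * f) - L t * L f) = L₀ f
      linarith⟩
    have hseg : L ∈ openSegment ℝ P M := by
      refine ⟨1/2, 1/2, by norm_num, by norm_num, by norm_num, ?_⟩
      ext a
      simp only [P, M, Pi.add_apply, Pi.smul_apply, smul_eq_mul]
      ring
    have := congrFun (hext P hPF M hMF hseg).1 b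
    simp only [P] at this
    linarith
  have hmulL : ∀ a b, L (a * b) = L a * L b := by
    intro a b
    set s := N a • (1 : E) - a with hs
    have hsT : s ∈ T := hN a
    set m : ℝ := max (N s) 1
    have hmpos : 0 < m := lt_of_lt_of_le one_pos (le_max_right _ _)
    have hmT : m • (1 : E) - s ∈ T := by
      have := hadd _ (hN s) _ (hsm (m - N s) (sub_nonneg.2 (le_max_left _ _)) 1 h1)
      convert this using 1
      rw [sub_smul]; abel
    have k := key (m⁻¹ • s) (hsm _ (by positivity) _ hsT) (by
      have := hsm m⁻¹ (by positivity) _ hmT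
      rwa [smul_sub, smul_smul, inv_mul_cancel₀ hmpos.ne', one_smul] at this) b
    rw [smul_mul_assoc, hLs, hLs, mul_assoc] at k
    have k2 : L (s * b) = L s * L b := mul_left_cancel₀ (inv_ne_zero hmpos.ne') k
    rw [hs, sub_mul, smul_mul_assoc, one_mul, hsub, hsub, hLs, hLs, hL1] at k2
    linarith
  refine ⟨AlgHom.ofLinearMap ⟨⟨L, hLa⟩, by simpa using hLs⟩ hL1 hmulL, hLp, ?_⟩
  show L f ≤ 0
  rw [hLf]; exact hm

/-- real coordinates of a complex vector -/
def rp {n : ℕ} (z : Fin n → ℂ) : Fin n ⊕ Fin n → ℝ :=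
  Sum.elim (fun j => (z j).re) (fun j => (z j).im)

/-- real polynomials which agree on the sphere with a sum of hermitian squares -/
def herm (n : ℕ) : Set (MvPolynomial (Fin n ⊕ Fin n) ℝ) :=
  {F | ∃ (ι : Type) (_ : Fintype ι) (p : ι → MvPolynomial (Fin n) ℂ),
    ∀ z : Fin n → ℂ, ∑ j, ‖z j‖ ^ 2 = 1 → eval (rp z) F = ∑ i, ‖eval z (p i)‖ ^ 2}

theorem real_parts {n : ℕ} (q : MvPolynomial (Fin n) ℂ) :
    ∃ u v : MvPolynomial (Fin n ⊕ Fin n) ℝ, ∀ z : Fin n → ℂ,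
      (eval z q).re = eval (rp z) u ∧ (eval z q).im = eval (rp z) v := by
  induction q using MvPolynomial.induction_on with
  | C a => exact ⟨C a.re, C a.im, fun z => by simp⟩
  | add p q hp hq =>
    obtain ⟨u, v, h⟩ := hp
    obtain ⟨u', v', h'⟩ := hq
    exact ⟨u + u', v + v', fun z => by simp [h z, h' z]⟩
  | mul_X p j hp =>
    obtain ⟨u, v, h⟩ := hp
    exact ⟨u * X (Sum.inl j) - v * X (Sum.inr j), u * X (Sum.inr j) + v * X (Sum.inl j),
      fun z => by simp [h z, rp]⟩

theorem herm_add {n : ℕ} : ∀ a ∈ herm n, ∀ b ∈ herm n, a + b ∈ herm n := by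
  rintro a ⟨ι, _, p, hp⟩ b ⟨κ, _, q, hq⟩
  refine ⟨ι ⊕ κ, inferInstance, Sum.elim p q, fun z hz => ?_⟩
  simp [hp z hz, hq z hz]

theorem herm_mul {n : ℕ} : ∀ a ∈ herm n, ∀ b ∈ herm n, a * b ∈ herm n := by
  rintro a ⟨ι, _, p, hp⟩ b ⟨κ, _, q, hq⟩
  refine ⟨ι × κ, inferInstance, fun x => p x.1 * q x.2, fun z hz => ?_⟩
  simp [hp z hz, hq z hz, Fintype.sum_prod_type, Finset.sum_mul_sum, mul_pow]

theorem herm_smul {n : ℕ} : ∀ r : ℝ, 0 ≤ r → ∀ a ∈ herm n, r • a ∈ herm n := by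
  rintro r hr a ⟨ι, _, p, hp⟩
  refine ⟨ι, inferInstance, fun x => C (Real.sqrt r : ℂ) * p x, fun z hz => ?_⟩
  simp [hp z hz, mul_pow, Finset.mul_sum, Real.sq_sqrt hr, MvPolynomial.smul_eval]

theorem herm_one {n : ℕ} : (1 : MvPolynomial (Fin n ⊕ Fin n) ℝ) ∈ herm n :=
  ⟨Unit, inferInstance, fun _ => 1, fun z hz => by simp⟩

theorem herm_lin {n : ℕ} (F : MvPolynomial (Fin n ⊕ Fin n) ℝ) (j : Fin n) (c : ℂ)
    (hc : ∀ z : Fin n → ℂ, eval (rp z) F = (1 + ‖z j‖ ^ 2) / 2 + (1 - ‖z j‖ ^ 2) / 2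
      - (‖z j‖ ^ 2 + 1 - ‖z j + c‖ ^ 2) / 2) : F ∈ herm n := by
  refine ⟨Unit ⊕ {k : Fin n // k ≠ j}, inferInstance,
    Sum.elim (fun _ => C ((Real.sqrt (1/2) : ℝ) : ℂ) * (X j + C c))
      (fun k => C ((Real.sqrt (1/2) : ℝ) : ℂ) * X k.1), fun z hz => ?_⟩
  rw [hc z]
  have h := Fintype.sum_eq_add_sum_subtype_ne (fun k => ‖z k‖ ^ 2) j
  rw [hz] at h
  have h2 : ‖((Real.sqrt (1/2) : ℝ) : ℂ)‖ ^ 2 = 1 / 2 := by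
    rw [Complex.norm_real, Real.norm_eq_abs, sq_abs, Real.sq_sqrt (by norm_num)]
  simp only [Fintype.sum_sum_type, Sum.elim_inl, Sum.elim_inr, map_mul, map_add, eval_C, eval_X,
    norm_mul, mul_pow, h2, ← Finset.mul_sum, Finset.univ_unique, Finset.sum_singleton]
  linarith

theorem herm_gen {n : ℕ} (j : Fin n ⊕ Fin n) : 1 + X j ∈ herm n ∧ 1 - X j ∈ herm n := by
  rcases j with j | j
  · constructor
    · refine herm_lin _ j 1 fun z => ?_
      simp [rp, ← Complex.normSq_eq_norm_sq, Complex.normSq_apply]; ring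
    · refine herm_lin _ j (-1) fun z => ?_
      simp [rp, ← Complex.normSq_eq_norm_sq, Complex.normSq_apply]; ring
  · constructor
    · refine herm_lin _ j Complex.I fun z => ?_
      simp [rp, ← Complex.normSq_eq_norm_sq, Complex.normSq_apply]; ring
    · refine herm_lin _ j (-Complex.I) fun z => ?_
      simp [rp, ← Complex.normSq_eq_norm_sq, Complex.normSq_apply]; ring

theorem herm_arch {n : ℕ} (a : MvPolynomial (Fin n ⊕ Fin n) ℝ) :
    ∃ N : ℝ, N • (1 : MvPolynomial (Fin n ⊕ Fin n) ℝ) + a ∈ herm n ∧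
      N • (1 : MvPolynomial (Fin n ⊕ Fin n) ℝ) - a ∈ herm n := by
  induction a using MvPolynomial.induction_on with
  | C r =>
    refine ⟨|r|, ?_, ?_⟩
    · have := herm_smul (n := n) (|r| + r) (by linarith [neg_abs_le r]) 1 herm_one
      convert this using 1
      simp [MvPolynomial.smul_eq_C_mul]
    · have := herm_smul (n := n) (|r| - r) (by linarith [le_abs_self r]) 1 herm_one
      convert this using 1
      simp [MvPolynomial.smul_eq_C_mul]
  | add p q hp hq =>
    obtain ⟨N, h1, h2⟩ := hp
    obtain ⟨M, h3, h4⟩ := hq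
    refine ⟨N + M, ?_, ?_⟩
    · convert herm_add _ h1 _ h3 using 1
      rw [add_smul]; ring
    · convert herm_add _ h2 _ h4 using 1
      rw [add_smul]; ring
  | mul_X p j hp =>
    obtain ⟨N, h1, h2⟩ := hp
    obtain ⟨h3, h4⟩ := herm_gen j
    have hC : (C (1/2 : ℝ) : MvPolynomial (Fin n ⊕ Fin n) ℝ) * 2 = 1 := by
      rw [show (2 : MvPolynomial (Fin n ⊕ Fin n) ℝ) = C 2 from (map_ofNat C 2).symm, ← C_mul]
      norm_num
    refine ⟨N, ?_, ?_⟩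
    · convert herm_smul (1/2) (by norm_num) _
        (herm_add _ (herm_mul _ h1 _ h3) _ (herm_mul _ h2 _ h4)) using 1
      simp only [MvPolynomial.smul_eq_C_mul]
      linear_combination (-(C N + p * X j)) * hC
    · convert herm_smul (1/2) (by norm_num) _
        (herm_add _ (herm_mul _ h1 _ h4) _ (herm_mul _ h2 _ h3)) using 1
      simp only [MvPolynomial.smul_eq_C_mul]
      linear_combination (-(C N - p * X j)) * hC

theorem herm_pos {n : ℕ} (f : MvPolynomial (Fin n ⊕ Fin n) ℝ)
    (hf : ∀ z : Fin n → ℂ, ∑ j, ‖z j‖ ^ 2 = 1 → 0 < eval (rp z) f) : f ∈ herm n := by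
  by_cases hS : ∃ z : Fin n → ℂ, ∑ j, ‖z j‖ ^ 2 = 1
  swap
  · exact ⟨Empty, inferInstance, fun _ => 0, fun z hz => (hS ⟨z, hz⟩).elim⟩
  obtain ⟨z₀, hz₀⟩ := hS
  by_contra hfT
  obtain ⟨φ, hφ, hφf⟩ := rep_main (herm n) herm_add herm_mul herm_smul herm_one
    (by
      rintro ⟨ι, _, p, hp⟩
      have h := hp z₀ hz₀
      have h2 : 0 ≤ ∑ i, ‖eval z₀ (p i)‖ ^ 2 := by positivity
      rw [← h] at h2
      simp at h2
      linarith)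
    (fun a => (herm_arch a).imp fun N h => h.2) f hfT
  let z : Fin n → ℂ := fun j => ⟨φ (X (Sum.inl j)), φ (X (Sum.inr j))⟩
  have hev : ∀ q, φ q = eval (rp z) q := by
    intro q
    have e : (φ ∘ X) = rp z := by
      ext j; rcases j with j | j <;> rfl
    conv_lhs => rw [aeval_unique φ, e]
    rfl
  let s : MvPolynomial (Fin n ⊕ Fin n) ℝ :=
    ∑ j, (X (Sum.inl j) * X (Sum.inl j) + X (Sum.inr j) * X (Sum.inr j)) - 1
  have hs : ∀ w : Fin n → ℂ, eval (rp w) s = ∑ j, ‖w j‖ ^ 2 - 1 := by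
    intro w
    simp [s, rp, ← Complex.normSq_eq_norm_sq, Complex.normSq_apply]
  have hs1 := hφ s ⟨Empty, inferInstance, fun _ => 0, fun w hw => by simp [hs, hw]⟩
  have hs2 := hφ (-s) ⟨Empty, inferInstance, fun _ => 0, fun w hw => by simp [hs, hw]⟩
  rw [hev, hs] at hs1
  rw [hev, map_neg, hs] at hs2
  have := hf z (by linarith)
  rw [← hev] at this
  linarith





/-- Any polynomial map `g` with `g(0) = 0` mapping the closed unit ball into the
open unit ball can be completed by a polynomial map `p` with `p(0) = 0` so that
`g ⊕ p` maps the unit sphere to the unit sphere, i.e. is a proper polynomial map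
between balls. -/
theorem polynomial_map_completion
    (n N : ℕ) (g : Fin N → MvPolynomial (Fin n) ℂ)
    (hg0 : ∀ i, eval (fun _ : Fin n => (0 : ℂ)) (g i) = 0)
    (hg : ∀ z : EuclideanSpace ℂ (Fin n), ‖z‖ ≤ 1 →
      ∑ i, ‖eval (fun j => z j) (g i)‖ ^ 2 < 1) :
    ∃ (K : ℕ) (p : Fin K → MvPolynomial (Fin n) ℂ),
      (∀ i, eval (fun _ : Fin n => (0 : ℂ)) (p i) = 0) ∧
      ∀ z : EuclideanSpace ℂ (Fin n), ‖z‖ = 1 →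
        (∑ i, ‖eval (fun j => z j) (g i)‖ ^ 2) +
          (∑ i, ‖eval (fun j => z j) (p i)‖ ^ 2) = 1 := by
  have hgr := fun i => real_parts (g i)
  choose u v huv using hgr
  obtain ⟨ι, _, p, hp⟩ := herm_pos (n := n) (1 - ∑ i, (u i * u i + v i * v i)) (by
    intro z hz
    have h := hg (WithLp.toLp 2 z) (by rw [EuclideanSpace.norm_eq]; simp [hz])
    simp only [← Complex.normSq_eq_norm_sq, Complex.normSq_apply, (huv _ _).1, (huv _ _).2] at h
    simpa using h)
  let e := Fintype.equivFin (Fin n × ι)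
  refine ⟨Fintype.card (Fin n × ι), fun i => X (e.symm i).1 * p (e.symm i).2, fun i => by simp, ?_⟩
  intro z hz
  have hz' : ∑ j, ‖z j‖ ^ 2 = 1 := by
    rw [← EuclideanSpace.norm_sq_eq, hz]; norm_num
  have h := hp (fun j => z j) hz'
  rw [Equiv.sum_comp e.symm (fun x : Fin n × ι => ‖eval (fun j => z j) (X x.1 * p x.2)‖ ^ 2)]
  simp only [map_mul, eval_X, norm_mul, mul_pow, Fintype.sum_prod_type]
  rw [← Finset.sum_mul_sum, hz', one_mul, ← h]
  simp only [← Complex.normSq_eq_norm_sq, Complex.normSq_apply, (huv _ _).1, (huv _ _).2]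
  simp
end

section
/- Fix integers n ≥ 1 and d ≥ 1, and let δ(n,m) = C(n+m, n) − 1 denote the dimension of the space of polynomials in n variables of degree at most m with vanishing constant term. Let S be the set of all functions on the open unit ball B_n of the form z ↦ ‖f(z)‖², where f : ℂ^n → ℂ^N (for some N) is a polynomial map of degree at most d with f(0) = 0 and ‖f(z)‖ = 1 for all z with ‖z‖ = 1. Then the affine span of S inside the real vector space of real-valued functions on B_n has dimension exactly δ(n,d−1)². -/
open MvPolynomial

namespace PPM
open Matrix

/-- multi-exponents of total degree between `1` and `m` -/
def K (n m : ℕ) : Finset (Fin n → ℕ) :=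
  (Finset.Icc 1 m).biUnion (fun k => Finset.piAntidiag Finset.univ k)

lemma mem_K {n m : ℕ} {a : Fin n → ℕ} : a ∈ K n m ↔ 1 ≤ ∑ i, a i ∧ ∑ i, a i ≤ m := by
  simp [K]

lemma disj_K (n : ℕ) (s : Set ℕ) :
    s.PairwiseDisjoint (fun k => Finset.piAntidiag (Finset.univ : Finset (Fin n)) k) := by
  intro i _ j _ hij
  rw [Function.onFun, Finset.disjoint_left]
  intro a ha hb
  simp at ha hb
  omega

lemma card_K (n m : ℕ) : (K n m).card = (n + m).choose n - 1 := by
  rw [K, Finset.card_biUnion (fun i hi j hj h => disj_K n Set.univ trivial trivial h)]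
  have h1 : ∀ k, (Finset.piAntidiag (Finset.univ : Finset (Fin n)) k).card
      = Nat.multichoose n k := by
    intro k
    have := Finset.card_finsuppAntidiag_nat_eq_multichoose (s := (Finset.univ : Finset (Fin n))) k
    rw [Finset.finsuppAntidiag, Finset.card_map, Finset.card_attach] at this
    simpa using this
  simp_rw [h1]
  have h2 := Nat.sum_range_multichoose m n
  rw [Finset.range_eq_Ico, Finset.sum_eq_sum_Ico_succ_bot (by omega)] at h2
  simp at h2
  have h3 : Finset.Ico 1 (m+1) = Finset.Icc 1 m := by ext; simp
  rw [h3, Nat.add_comm m n] at h2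
  omega

/-- vector of monomials -/
def mon {n m : ℕ} (z : Fin n → ℂ) : K n m → ℂ := fun a => ∏ j, z j ^ a.1 j

/-- hermitian form evaluation -/
def ev {n m : ℕ} (C : Matrix (K n m) (K n m) ℂ) (z : Fin n → ℂ) : ℂ :=
  star (mon z) ⬝ᵥ (C *ᵥ mon z)

lemma ev_eq {n m : ℕ} (C : Matrix (K n m) (K n m) ℂ) (z : Fin n → ℂ) :
    ev C z = ∑ a : K n m, ∑ b : K n m,
      C a b * ((∏ j, star (z j) ^ a.1 j) * ∏ j, z j ^ b.1 j) := by
  simp only [ev, dotProduct, mulVec, mon, Finset.mul_sum, Pi.star_apply, star_prod, star_pow]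
  refine Finset.sum_congr rfl fun a _ => Finset.sum_congr rfl fun b _ => ?_
  ring

lemma pol {n : ℕ} (Q : MvPolynomial (Fin n ⊕ Fin n) ℂ) (ε : ℝ) (hε : 0 < ε)
    (h : ∀ z : Fin n → ℂ, (∀ j, ‖z j‖ < ε) →
      eval (Sum.elim (fun j => star (z j)) z) Q = 0) : Q = 0 := by
  let g : Fin n ⊕ Fin n → MvPolynomial (Fin n ⊕ Fin n) ℂ :=
    Sum.elim (fun j => X (Sum.inl j) - C Complex.I * X (Sum.inr j))
      (fun j => X (Sum.inl j) + C Complex.I * X (Sum.inr j))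
  have hev : ∀ x : Fin n ⊕ Fin n → ℂ, eval x (bind₁ g Q) =
      eval (Sum.elim (fun j => x (Sum.inl j) - Complex.I * x (Sum.inr j))
        (fun j => x (Sum.inl j) + Complex.I * x (Sum.inr j))) Q := by
    intro x
    have e1 : eval x (bind₁ g Q) = eval (fun i => eval x (g i)) Q := by
      exact MvPolynomial.eval₂Hom_bind₁ (RingHom.id ℂ) x g Q
    rw [e1]
    congr 2
    ext i
    rcases i with i | i <;> simp [g]
  have hz : bind₁ g Q = 0 := by
    refine MvPolynomial.funext_set (fun _ => (fun t : ℝ => (t : ℂ)) '' Set.Ioo 0 (ε/2))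
      (fun _ => ((Set.Ioo_infinite (by positivity)).image
        (Complex.ofReal_injective.injOn))) ?_
    intro x hx
    rw [hev, map_zero]
    have hx' : ∀ i, ∃ t : ℝ, (0 < t ∧ t < ε/2) ∧ (t : ℂ) = x i := fun i => hx i trivial
    choose t ht hxt using hx'
    have := h (fun j => t (Sum.inl j) + Complex.I * t (Sum.inr j)) (fun j => by
      refine (norm_add_le _ _).trans_lt ?_
      have h1 := ht (Sum.inl j)
      have h2 := ht (Sum.inr j)
      simp only [norm_mul, Complex.norm_I, one_mul, Complex.norm_real, Real.norm_eq_abs]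
      rw [abs_of_pos h1.1, abs_of_pos h2.1]
      linarith)
    rw [← this]
    congr 2
    ext i
    rcases i with i | i <;> simp [hxt, sub_eq_add_neg]
    all_goals simp [← hxt]
  refine MvPolynomial.funext fun y => ?_
  have := hev (Sum.elim (fun j => (y (Sum.inr j) + y (Sum.inl j))/2)
    (fun j => (y (Sum.inr j) - y (Sum.inl j))/2 * (-Complex.I)))
  rw [hz, map_zero] at this
  rw [map_zero, this]
  congr 2
  ext i
  rcases i with i | i <;> simp only [Sum.elim_inl, Sum.elim_inr] <;>
    ring_nf <;> simp [Complex.I_sq] <;> ring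

lemma ev_inj {n m : ℕ} (A : Matrix (K n m) (K n m) ℂ) (ε : ℝ) (hε : 0 < ε)
    (h : ∀ z : Fin n → ℂ, (∀ j, ‖z j‖ < ε) → ev A z = 0) : A = 0 := by
  let e : K n m → K n m → (Fin n ⊕ Fin n →₀ ℕ) := fun a b =>
    Finsupp.equivFunOnFinite.symm (Sum.elim a.1 b.1)
  have he : ∀ a b a' b', e a b = e a' b' → a = a' ∧ b = b' := by
    intro a b a' b' hh
    have hh := Finsupp.equivFunOnFinite.symm.injective hh
    constructor
    · ext j; exact congrFun hh (Sum.inl j)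
    · ext j; exact congrFun hh (Sum.inr j)
  have hQ := pol (∑ a, ∑ b, monomial (e a b) (A a b)) ε hε (fun z hz => by
    rw [← h z hz, ev_eq]
    simp only [map_sum, eval_monomial]
    refine Finset.sum_congr rfl fun a _ => Finset.sum_congr rfl fun b _ => ?_
    congr 1
    rw [Finsupp.prod_fintype _ _ (by simp)]
    simp [e])
  ext a b
  have := congrArg (coeff (e a b)) hQ
  simp only [coeff_sum, coeff_monomial, coeff_zero] at this
  rw [Finset.sum_eq_single a, Finset.sum_eq_single b] at this
  · simpa using this
  · intro b' _ hb; rw [if_neg]; intro hh; exact hb (he _ _ _ _ hh).2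
  · simp
  · intro a' _ hb; refine Finset.sum_eq_zero fun b' _ => ?_
    rw [if_neg]; intro hh; exact hb (he _ _ _ _ hh).1
  · simp

lemma ev_inj_ball {n m : ℕ} (A : Matrix (K n m) (K n m) ℂ)
    (h : ∀ z : EuclideanSpace ℂ (Fin n), ‖z‖ < 1 → ev A (fun j => z j) = 0) : A = 0 := by
  refine ev_inj A (1/(n+1)) (by positivity) fun z hz => ?_
  refine h (WithLp.toLp 2 z) ?_
  rw [EuclideanSpace.norm_eq, Real.sqrt_lt' (by norm_num)]
  have : ∑ i, ‖z i‖^2 ≤ ∑ i : Fin n, (1/(n+1:ℝ))^2 :=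
    Finset.sum_le_sum fun i _ => by
      have := hz i
      gcongr
  refine this.trans_lt ?_
  simp only [Finset.sum_const, Finset.card_univ, Fintype.card_fin, nsmul_eq_mul]
  rw [div_pow, one_pow, mul_one_div, div_lt_iff₀ (by positivity)]
  nlinarith [(Nat.cast_nonneg n : (0:ℝ) ≤ n)]

lemma ev_smul {n m : ℕ} (A : Matrix (K n m) (K n m) ℂ) (l : ℂ) (z : Fin n → ℂ) :
    ev A (fun j => l * z j) = ∑ a : K n m, ∑ b : K n m,
      star l ^ (∑ j, a.1 j) * l ^ (∑ j, b.1 j) *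
      (A a b * ((∏ j, star (z j) ^ a.1 j) * ∏ j, z j ^ b.1 j)) := by
  rw [ev_eq]
  refine Finset.sum_congr rfl fun a _ => Finset.sum_congr rfl fun b _ => ?_
  simp only [star_mul', mul_pow, Finset.prod_mul_distrib, Finset.prod_pow_eq_pow_sum]
  ring

lemma circle_inf : {l : ℂ | ‖l‖ = 1}.Infinite := by
  refine Set.Infinite.of_image Complex.re (Set.Infinite.mono ?_ (Set.Ioo_infinite (zero_lt_one' ℝ)))
  intro x hx
  refine ⟨⟨x, Real.sqrt (1 - x^2)⟩, ?_, rfl⟩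
  change ‖_‖ = 1
  have h1 : 0 ≤ 1 - x^2 := by nlinarith [hx.1, hx.2]
  rw [← sq_eq_sq₀ (norm_nonneg _) zero_le_one, ← Complex.normSq_eq_norm_sq, Complex.normSq_mk,
    Real.mul_self_sqrt h1]
  ring

lemma top_inj {n d : ℕ} (A : Matrix (K n d) (K n d) ℂ)
    (h0 : ∀ a b : K n d, ∑ j, a.1 j < d → ∑ j, b.1 j < d → A a b = 0)
    (h : ∀ z : EuclideanSpace ℂ (Fin n), ‖z‖ = 1 → ev A (fun j => z j) = 0) : A = 0 := by
  refine ev_inj A 1 one_pos fun w _ => ?_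
  by_cases hw : WithLp.toLp 2 w = 0
  · have hw0 : ∀ j, w j = 0 := fun j => congrFun (congrArg WithLp.ofLp hw) j
    rw [ev_eq]
    refine Finset.sum_eq_zero fun a _ => Finset.sum_eq_zero fun b _ => ?_
    have : ∏ j, w j ^ b.1 j = 0 := by
      simp only [hw0, Finset.prod_pow_eq_pow_sum]
      have := (mem_K.1 b.2).1
      exact zero_pow (by omega)
    rw [this]; simp
  set s : ℝ := ‖WithLp.toLp 2 w‖ with hs
  have hspos : 0 < s := norm_pos_iff.2 hw
  set u : Fin n → ℂ := fun j => (s:ℂ)⁻¹ * w j with hu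
  have hun : ‖WithLp.toLp 2 u‖ = 1 := by
    have : WithLp.toLp 2 u = (s:ℂ)⁻¹ • WithLp.toLp 2 w := by ext j; simp [hu]
    rw [this, norm_smul, norm_inv, Complex.norm_real, Real.norm_of_nonneg hspos.le, ← hs]
    exact inv_mul_cancel₀ hspos.ne'
  have hwu : w = fun j => (s:ℂ) * u j := by
    ext j; simp only [hu]; rw [mul_inv_cancel_left₀]; exact_mod_cast hspos.ne'
  set T : K n d × K n d → ℂ := fun p =>
    A p.1 p.2 * ((∏ j, star (u j) ^ p.1.1 j) * ∏ j, u j ^ p.2.1 j) with hT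
  set ex : K n d × K n d → ℕ := fun p => d - (∑ j, p.1.1 j) + ∑ j, p.2.1 j with hex
  have hpoly : (∑ p, Polynomial.monomial (ex p) (T p)) = 0 := by
    refine Polynomial.eq_zero_of_infinite_isRoot _ (circle_inf.mono ?_)
    intro l hl
    have hl : ‖l‖ = 1 := hl
    have hll : star l * l = 1 := by
      have := Complex.conj_mul' l
      rw [hl] at this
      simpa using this
    have h1 := h (WithLp.toLp 2 (fun j => l * u j)) (by
      have : WithLp.toLp 2 (fun j => l * u j) = l • WithLp.toLp 2 u := by ext j; simp
      rw [this, norm_smul, hl, hun, one_mul])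
    have h1 : ev A (fun j => l * u j) = 0 := h1
    rw [ev_smul] at h1
    have h2 := congrArg (fun x => l ^ d * x) h1
    simp only [Finset.mul_sum, mul_zero] at h2
    simp only [Set.mem_ofPred_eq, Polynomial.IsRoot, Polynomial.eval_finsetSum,
      Polynomial.eval_monomial]
    rw [← h2, Fintype.sum_prod_type]
    refine Finset.sum_congr rfl fun a _ => Finset.sum_congr rfl fun b _ => ?_
    have ha := (mem_K.1 a.2).2
    simp only [hT, hex, pow_add]
    have : l ^ d * star l ^ (∑ j, a.1 j) = l ^ (d - ∑ j, a.1 j) := by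
      nth_rw 1 [← Nat.sub_add_cancel ha]
      rw [pow_add, mul_assoc, ← mul_pow, mul_comm l, hll]; simp
    rw [← this]; ring
  rw [hwu, ev_smul, ← Fintype.sum_prod_type']
  let φ : ℕ → ℕ := fun k => if k ≤ d then d + k else 3 * d - k
  have h3 : ∀ p : K n d × K n d, star (s:ℂ) ^ (∑ j, p.1.1 j) * (s:ℂ) ^ (∑ j, p.2.1 j) * T p
      = (s:ℂ) ^ φ (ex p) * T p := by
    intro p
    by_cases hA : A p.1 p.2 = 0
    · simp [hT, hA]
    · have hp : ¬ (∑ j, p.1.1 j < d ∧ ∑ j, p.2.1 j < d) := fun hh => hA (h0 _ _ hh.1 hh.2)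
      have h1 := mem_K.1 p.1.2
      have h2 := mem_K.1 p.2.2
      congr 1
      simp only [Complex.star_def, Complex.conj_ofReal]
      rw [← pow_add]
      congr 1
      simp only [φ, hex]
      split_ifs <;> omega
  rw [Finset.sum_congr rfl fun p _ => h3 p]
  have h4 : ∀ p ∈ Finset.univ, ex p ∈ Finset.range (2*d+1) := by
    intro p _
    have h2 := mem_K.1 p.2.2
    simp only [hex, Finset.mem_range]; omega
  rw [← Finset.sum_fiberwise_of_maps_to h4]
  refine Finset.sum_eq_zero fun k _ => ?_
  have h5 := congrArg (fun q => Polynomial.coeff q k) hpoly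
  simp only [Polynomial.finsetSum_coeff, Polynomial.coeff_monomial, Polynomial.coeff_zero] at h5
  rw [← Finset.sum_filter] at h5
  calc _ = ∑ p with ex p = k, (s:ℂ) ^ φ k * T p := by
        refine Finset.sum_congr rfl fun p hp => ?_
        rw [(Finset.mem_filter.1 hp).2]
    _ = 0 := by rw [← Finset.mul_sum, h5, mul_zero]



open scoped ComplexOrder MatrixOrder

lemma finrank_sa (ι : Type) [Fintype ι] [DecidableEq ι] :
    Module.finrank ℝ (selfAdjoint.submodule ℝ (Matrix ι ι ℂ)) = Fintype.card ι ^ 2 := by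
  have h1 : Module.finrank ℝ (Matrix ι ι ℂ) = 2 * Fintype.card ι ^ 2 := by
    rw [finrank_real_of_complex, Module.finrank_matrix]; simp [sq]
  have h2 := (StarModule.decomposeProdAdjoint ℝ (Matrix ι ι ℂ)).finrank_eq
  have e : skewAdjoint (Matrix ι ι ℂ) ≃ₗ[ℝ] selfAdjoint (Matrix ι ι ℂ) := by
    refine LinearEquiv.ofBijective skewAdjoint.negISMul ⟨?_, ?_⟩
    · intro a b hab
      ext1
      rw [← skewAdjoint.I_smul_neg_I a, hab, skewAdjoint.I_smul_neg_I]
    · intro b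
      refine ⟨⟨Complex.I • (b : Matrix ι ι ℂ), ?_⟩, ?_⟩
      · exact Complex.I_smul_mem_skewAdjoint_iff_isSelfAdjoint.2 b.2
      · ext1; simp [smul_smul]
  have : FiniteDimensional ℝ (selfAdjoint (Matrix ι ι ℂ)) :=
    inferInstanceAs (FiniteDimensional ℝ (selfAdjoint.submodule ℝ (Matrix ι ι ℂ)))
  have : FiniteDimensional ℝ (skewAdjoint (Matrix ι ι ℂ)) := e.symm.finiteDimensional
  rw [Module.finrank_prod, e.finrank_eq, h1] at h2
  change Module.finrank ℝ (selfAdjoint (Matrix ι ι ℂ)) = _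
  omega

lemma ev_herm {n m : ℕ} {A : Matrix (K n m) (K n m) ℂ} (hA : A.IsHermitian) (z : Fin n → ℂ) :
    ((ev A z).re : ℂ) = ev A z := by
  rw [← Complex.conj_eq_iff_re, ← Complex.star_def]
  rw [ev, ← star_dotProduct, star_mulVec, hA.eq, ← dotProduct_mulVec]

/-- evaluation as complex linear map -/
def evL {n m : ℕ} (z : Fin n → ℂ) : Matrix (K n m) (K n m) ℂ →ₗ[ℂ] ℂ where
  toFun C := ev C z
  map_add' A B := by simp [ev, add_mulVec]
  map_smul' c A := by simp [ev, smul_mulVec]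

lemma ev_add {n m : ℕ} (A B : Matrix (K n m) (K n m) ℂ) (z) : ev (A + B) z = ev A z + ev B z :=
  (evL z).map_add A B

lemma ev_sub {n m : ℕ} (A B : Matrix (K n m) (K n m) ℂ) (z) : ev (A - B) z = ev A z - ev B z :=
  (evL z).map_sub A B

lemma ev_rsmul {n m : ℕ} (c : ℝ) (A : Matrix (K n m) (K n m) ℂ) (z) :
    ev (c • A) z = c * ev A z := by
  rw [show c • A = (c:ℂ) • A by ext; simp]
  exact (evL z).map_smul (c:ℂ) A

lemma ev_zero {n m : ℕ} (z : Fin n → ℂ) : ev (0 : Matrix (K n m) (K n m) ℂ) z = 0 :=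
  (evL z).map_zero

lemma ev_sum {n m : ℕ} {ι : Type} (s : Finset ι) (A : ι → Matrix (K n m) (K n m) ℂ) (z) :
    ev (∑ i ∈ s, A i) z = ∑ i ∈ s, ev (A i) z :=
  map_sum (evL z) A s

/-- hermitian matrices vanishing on the sphere -/
def W (n d : ℕ) : Submodule ℝ (Matrix (K n d) (K n d) ℂ) where
  carrier := {A | A.IsHermitian ∧
    ∀ z : EuclideanSpace ℂ (Fin n), ‖z‖ = 1 → ev A (fun j => z j) = 0}
  zero_mem' := ⟨isHermitian_zero, fun z _ => ev_zero _⟩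
  add_mem' := by
    rintro A B ⟨h1, h2⟩ ⟨h3, h4⟩
    exact ⟨h1.add h3, fun z hz => by rw [ev_add, h2 z hz, h4 z hz, add_zero]⟩
  smul_mem' := by
    rintro c A ⟨h1, h2⟩
    refine ⟨?_, fun z hz => by rw [ev_rsmul, h2 z hz, mul_zero]⟩
    rw [Matrix.IsHermitian, conjTranspose_smul, h1.eq]; simp

lemma mem_W {n d : ℕ} {A : Matrix (K n d) (K n d) ℂ} : A ∈ W n d ↔ A.IsHermitian ∧
    ∀ z : EuclideanSpace ℂ (Fin n), ‖z‖ = 1 → ev A (fun j => z j) = 0 := Iff.rfl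

/-- evaluation on the ball -/
def E (n d : ℕ) : Matrix (K n d) (K n d) ℂ →ₗ[ℝ]
    ((Metric.ball (0 : EuclideanSpace ℂ (Fin n)) 1) → ℝ) where
  toFun A := fun z => (ev A (fun j => (z : EuclideanSpace ℂ (Fin n)) j)).re
  map_add' A B := by ext z; simp [ev_add]
  map_smul' c A := by ext z; simp [ev_rsmul]

lemma E_inj {n d : ℕ} {A : Matrix (K n d) (K n d) ℂ} (hA : A.IsHermitian) (h : E n d A = 0) :
    A = 0 := by
  refine ev_inj_ball A fun z hz => ?_
  have := congrFun h ⟨z, by simpa using hz⟩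
  rw [← ev_herm hA]
  exact_mod_cast this

/-- inclusion of smaller exponents -/
def inc (n m : ℕ) (a : K n m) : K n (m+1) := ⟨a.1, by
  have := mem_K.1 a.2
  exact mem_K.2 ⟨this.1, by omega⟩⟩

/-- shift of exponents -/
def shift (n m : ℕ) (i : Fin n) (a : K n m) : K n (m+1) := ⟨a.1 + Pi.single i 1, by
  have := mem_K.1 a.2
  rw [mem_K]
  simp only [Pi.add_apply, Finset.sum_add_distrib, Finset.sum_pi_single', Finset.mem_univ, if_true]
  omega⟩

/-- 0-1 matrix of a map -/
def PM {n m : ℕ} (s : K n m → K n (m+1)) : Matrix (K n (m+1)) (K n m) ℂ :=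
  Matrix.of fun c a => if c = s a then 1 else 0

lemma PM_mulVec {n m : ℕ} (s : K n m → K n (m+1)) (v : K n (m+1) → ℂ) (a) :
    ((PM s)ᴴ *ᵥ v) a = v (s a) := by
  simp [PM, mulVec, dotProduct, conjTranspose_apply, apply_ite]

lemma ev_PM {n m : ℕ} (s : K n m → K n (m+1)) (A : Matrix (K n m) (K n m) ℂ) (z : Fin n → ℂ)
    (c : ℂ) (hs : ∀ a, mon z (s a) = c * mon z a) :
    ev (PM s * A * (PM s)ᴴ) z = (‖c‖^2 : ℝ) * ev A z := by
  have h : (PM s)ᴴ *ᵥ mon z = c • mon z := by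
    ext a; rw [PM_mulVec, hs]; rfl
  have h' : star (mon z) ᵥ* PM s = star (c • mon z) := by
    rw [← h, star_mulVec, conjTranspose_conjTranspose]
  rw [ev, ← mulVec_mulVec, ← mulVec_mulVec, h, dotProduct_mulVec, h']
  simp only [ev, mulVec_smul, star_smul, smul_dotProduct, dotProduct_smul, smul_eq_mul]
  rw [← mul_assoc]
  congr 1
  have := Complex.mul_conj' c
  push_cast
  exact this

/-- multiplication by `‖z‖² - 1` -/
def Mul (n m : ℕ) : Matrix (K n m) (K n m) ℂ →ₗ[ℝ] Matrix (K n (m+1)) (K n (m+1)) ℂ where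
  toFun A := ∑ i, PM (shift n m i) * A * (PM (shift n m i))ᴴ - PM (inc n m) * A * (PM (inc n m))ᴴ
  map_add' A B := by
    simp only [Matrix.mul_add, Matrix.add_mul, Finset.sum_add_distrib]; abel
  map_smul' c A := by
    simp only [Matrix.mul_smul, Matrix.smul_mul, RingHom.id_apply, smul_sub, Finset.smul_sum]

lemma ev_Mul {n m : ℕ} (A : Matrix (K n m) (K n m) ℂ) (z : EuclideanSpace ℂ (Fin n)) :
    ev (Mul n m A) (fun j => z j) = ((‖z‖^2 - 1 : ℝ) : ℂ) * ev A (fun j => z j) := by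
  change ev (_ - _) _ = _
  rw [ev_sub, ev_sum, ev_PM (inc n m) A _ 1 (fun a => by simp [mon, inc])]
  have : ∀ i, ev (PM (shift n m i) * A * (PM (shift n m i))ᴴ) (fun j => z j)
      = (‖z i‖^2 : ℝ) * ev A (fun j => z j) := by
    intro i
    refine ev_PM _ _ _ _ fun a => ?_
    simp only [mon, shift, Pi.add_apply, pow_add, Finset.prod_mul_distrib]
    rw [mul_comm]
    congr 1
    rw [Finset.prod_eq_single i]
    · simp
    · intro b _ hb; simp [Pi.single_eq_of_ne hb]
    · simp
  simp only [this, ← Finset.sum_mul]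
  rw [EuclideanSpace.norm_sq_eq]
  push_cast
  simp
  ring

lemma Mul_mem {n m : ℕ} {A : Matrix (K n m) (K n m) ℂ} (hA : A.IsHermitian) :
    Mul n m A ∈ W n (m+1) := by
  refine ⟨?_, fun z hz => by rw [ev_Mul, hz]; simp⟩
  have h : ∀ s : K n m → K n (m+1), (PM s * A * (PM s)ᴴ).IsHermitian := fun s =>
    isHermitian_mul_mul_conjTranspose _ hA
  refine IsHermitian.sub ?_ (h _)
  rw [Matrix.IsHermitian, conjTranspose_sum]
  exact Finset.sum_congr rfl fun i _ => (h _).eq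

lemma Mul_inj {n m : ℕ} {A : Matrix (K n m) (K n m) ℂ} (h : Mul n m A = 0) : A = 0 := by
  refine ev_inj_ball A fun z hz => ?_
  have := ev_Mul A z
  rw [h, ev_zero] at this
  rcases mul_eq_zero.1 this.symm with h1 | h1
  · have h1 : ‖z‖^2 - 1 = 0 := by exact_mod_cast h1
    nlinarith [norm_nonneg z]
  · exact h1

lemma finrank_W (n m : ℕ) : Module.finrank ℝ (W n (m+1)) = ((n + m).choose n - 1) ^ 2 := by
  have hc : Fintype.card (K n m) = (n + m).choose n - 1 := by simp [card_K]
  rw [← hc, ← finrank_sa]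
  apply le_antisymm
  · let f : W n (m+1) →ₗ[ℝ] selfAdjoint.submodule ℝ (Matrix (K n m) (K n m) ℂ) :=
      { toFun := fun A => ⟨A.1.submatrix (inc n m) (inc n m), A.2.1.submatrix _⟩
        map_add' := fun A B => rfl
        map_smul' := fun c A => rfl }
    refine LinearMap.finrank_le_finrank_of_injective (f := f) ?_
    rw [← LinearMap.ker_eq_bot, LinearMap.ker_eq_bot']
    intro A hA
    ext1
    refine top_inj A.1 ?_ A.2.2
    intro a b ha hb
    have h1 := congrArg Subtype.val hA
    exact congrFun (congrFun h1 ⟨a.1, mem_K.2 ⟨(mem_K.1 a.2).1, by omega⟩⟩)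
      ⟨b.1, mem_K.2 ⟨(mem_K.1 b.2).1, by omega⟩⟩
  · let f : selfAdjoint.submodule ℝ (Matrix (K n m) (K n m) ℂ) →ₗ[ℝ] W n (m+1) :=
      ((Mul n m).comp (Submodule.subtype _)).codRestrict _ (fun A => Mul_mem A.2)
    refine LinearMap.finrank_le_finrank_of_injective (f := f) ?_
    rw [← LinearMap.ker_eq_bot, LinearMap.ker_eq_bot']
    intro A hA
    ext1
    exact Mul_inj (congrArg Subtype.val hA)

lemma perturb {ι : Type} [Fintype ι] [DecidableEq ι] (D : ι → ℝ) (c : ℝ) (hc : 0 < c)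
    (hD : ∀ a, c ≤ D a) (A : Matrix ι ι ℂ) (hA : A.IsHermitian) :
    ∃ ε : ℝ, 0 < ε ∧ (Matrix.diagonal (fun a => (D a : ℂ)) + ε • A).PosSemidef := by
  set M := ∑ a, ∑ b, ‖A a b‖ with hM
  have hM0 : 0 ≤ M := by positivity
  refine ⟨c / (M + 1), by positivity, ?_⟩
  set ε := c / (M + 1) with hε
  have hε0 : 0 < ε := by positivity
  have hH : (Matrix.diagonal (fun a => (D a : ℂ)) + ε • A).IsHermitian := by
    refine IsHermitian.add ?_ ?_
    · rw [Matrix.IsHermitian, diagonal_conjTranspose]; congr 1; ext a; simp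
    · rw [Matrix.IsHermitian, conjTranspose_smul, hA.eq]; simp
  refine PosSemidef.of_dotProduct_mulVec_nonneg hH fun x => ?_
  have him : (star x ⬝ᵥ ((Matrix.diagonal (fun a => (D a : ℂ)) + ε • A) *ᵥ x)).im = 0 := by
    rw [← Complex.conj_eq_iff_im, ← Complex.star_def]
    rw [← star_dotProduct, star_mulVec, hH.eq, ← dotProduct_mulVec]
  rw [Complex.nonneg_iff]
  refine ⟨?_, him.symm⟩
  set X := ∑ a, ‖x a‖^2 with hX
  have hX0 : 0 ≤ X := by positivity
  have hle : ∀ a, ‖x a‖^2 ≤ X := fun a =>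
    Finset.single_le_sum (f := fun a => ‖x a‖^2) (fun _ _ => by positivity) (Finset.mem_univ a)
  have h1 : (star x ⬝ᵥ (Matrix.diagonal (fun a => (D a : ℂ)) *ᵥ x)).re = ∑ a, D a * ‖x a‖^2 := by
    simp only [dotProduct, mulVec_diagonal, Pi.star_apply, Complex.re_sum]
    refine Finset.sum_congr rfl fun a _ => ?_
    have : star (x a) * ((D a : ℂ) * x a) = ((D a * ‖x a‖^2 : ℝ) : ℂ) := by
      have := Complex.conj_mul' (x a)
      push_cast
      rw [← this, Complex.star_def]; ring
    rw [this, Complex.ofReal_re]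
  have h2 : c * X ≤ ∑ a, D a * ‖x a‖^2 := by
    rw [hX, Finset.mul_sum]
    exact Finset.sum_le_sum fun a _ => mul_le_mul_of_nonneg_right (hD a) (by positivity)
  have h3 : ‖star x ⬝ᵥ (A *ᵥ x)‖ ≤ M * X := by
    simp only [dotProduct, mulVec, Finset.mul_sum, hM, Finset.sum_mul]
    refine (norm_sum_le _ _).trans (Finset.sum_le_sum fun a _ => ?_)
    refine (norm_sum_le _ _).trans (Finset.sum_le_sum fun b _ => ?_)
    simp only [norm_mul, Pi.star_apply, norm_star]
    have : ‖x a‖ * ‖x b‖ ≤ X := by nlinarith [hle a, hle b, sq_nonneg (‖x a‖ - ‖x b‖)]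
    calc ‖x a‖ * (‖A a b‖ * ‖x b‖) = ‖A a b‖ * (‖x a‖ * ‖x b‖) := by ring
      _ ≤ ‖A a b‖ * X := by gcongr
  have h4 : -(M * X) ≤ (star x ⬝ᵥ (A *ᵥ x)).re := by
    have := Complex.abs_re_le_norm (star x ⬝ᵥ (A *ᵥ x))
    have := neg_abs_le (star x ⬝ᵥ (A *ᵥ x)).re
    linarith
  rw [add_mulVec, dotProduct_add, Complex.add_re, h1, smul_mulVec, dotProduct_smul,
    Complex.smul_re, smul_eq_mul]
  have h5 : ε * (M + 1) = c := by rw [hε]; field_simp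
  have h6 : 0 ≤ ε * X := by positivity
  nlinarith [mul_le_mul_of_nonneg_left h4 hε0.le]

/-- reference weights -/
noncomputable def Dw (n d : ℕ) (a : K n d) : ℝ := Nat.multinomial Finset.univ a.1 / d

lemma ev_Dw (n d : ℕ) (hd : 1 ≤ d) (z : EuclideanSpace ℂ (Fin n)) (hz : ‖z‖ = 1) :
    ev (Matrix.diagonal (fun a => (Dw n d a : ℂ))) (fun j => z j) = 1 := by
  have h1 : ev (Matrix.diagonal (fun a => (Dw n d a : ℂ))) (fun j => z j)
      = ((∑ a : K n d, Dw n d a * ∏ j, (‖z j‖^2) ^ a.1 j : ℝ) : ℂ) := by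
    simp only [ev, dotProduct, mulVec_diagonal, Pi.star_apply, mon, star_prod]
    push_cast
    refine Finset.sum_congr rfl fun a _ => ?_
    rw [mul_left_comm, ← Finset.prod_mul_distrib]
    congr 1
    refine Finset.prod_congr rfl fun j _ => ?_
    rw [star_pow, ← mul_pow, ← Complex.conj_mul', Complex.star_def]
  rw [h1]
  have h2 : ∑ a : K n d, Dw n d a * ∏ j, (‖z j‖^2) ^ a.1 j = 1 := by
    have h3 : ∑ a : K n d, Dw n d a * ∏ j, (‖z j‖^2) ^ a.1 j
       = ∑ a ∈ K n d, (Nat.multinomial Finset.univ a / d : ℝ) * ∏ j, (‖z j‖^2) ^ a j :=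
      Finset.sum_coe_sort (K n d)
        (fun a => (Nat.multinomial Finset.univ a / d : ℝ) * ∏ j, (‖z j‖^2) ^ a j)
    rw [h3, K, Finset.sum_biUnion (fun i hi j hj h => disj_K n Set.univ trivial trivial h)]
    have h4 : ∀ k, ∑ a ∈ Finset.piAntidiag Finset.univ k,
        (Nat.multinomial Finset.univ a / d : ℝ) * ∏ j, (‖z j‖^2) ^ a j = 1 / d := by
      intro k
      have := Finset.sum_pow_eq_sum_piAntidiag Finset.univ (fun j => ‖z j‖^2) k
      rw [← EuclideanSpace.norm_sq_eq, hz] at this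
      simp only [one_pow] at this
      rw [this, Finset.sum_div]
      refine Finset.sum_congr rfl fun a _ => ?_
      ring
    simp only [h4, Finset.sum_const, Nat.card_Icc]
    have : (d:ℝ) ≠ 0 := by positivity
    simp [this]
  rw [h2]; simp

lemma Dw_ge (n d : ℕ) (hd : 1 ≤ d) (a : K n d) : 1 / (d:ℝ) ≤ Dw n d a := by
  unfold Dw
  gcongr
  exact_mod_cast Nat.multinomial_pos _ _

lemma ev_sq {n d : ℕ} {ι : Type} [Fintype ι] (B : Matrix ι (K n d) ℂ) (z : Fin n → ℂ) :
    ev (Bᴴ * B) z = ((∑ i, ‖∑ a, B i a * mon z a‖^2 : ℝ) : ℂ) := by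
  rw [ev, ← mulVec_mulVec, dotProduct_mulVec, ← star_mulVec]
  simp only [dotProduct, mulVec, Pi.star_apply]
  push_cast
  refine Finset.sum_congr rfl fun i _ => ?_
  rw [← Complex.conj_mul', Complex.star_def]

lemma eval_repr {n d : ℕ} (f : MvPolynomial (Fin n) ℂ) (hf : f.totalDegree ≤ d)
    (h0 : eval (fun _ : Fin n => (0 : ℂ)) f = 0) (z : Fin n → ℂ) :
    eval z f = ∑ a : K n d, coeff (Finsupp.equivFunOnFinite.symm a.1) f * mon z a := by
  have h3 : ∑ a : K n d, coeff (Finsupp.equivFunOnFinite.symm a.1) f * mon z a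
      = ∑ a ∈ K n d, coeff (Finsupp.equivFunOnFinite.symm a) f * ∏ j, z j ^ a j :=
    Finset.sum_coe_sort (K n d)
      (fun a => coeff (Finsupp.equivFunOnFinite.symm a) f * ∏ j, z j ^ a j)
  have h4 := Finset.sum_map (K n d) (Finsupp.equivFunOnFinite : (Fin n →₀ ℕ) ≃ (Fin n → ℕ)).symm.toEmbedding
    (fun a => coeff a f * ∏ j, z j ^ a j)
  rw [h3, eval_eq']
  refine Eq.trans ?_ h4
  refine Finset.sum_subset ?_ ?_
  · intro a ha
    simp only [Finset.mem_map_equiv, Equiv.symm_symm, mem_K]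
    have h1 := le_totalDegree ha
    rw [Finsupp.sum_fintype _ _ (by simp)] at h1
    refine ⟨?_, h1.trans hf⟩
    by_contra hlt
    have : a = 0 := by
      ext j
      have : ∑ i, a i = 0 := by simpa using hlt
      exact (Finset.sum_eq_zero_iff.1 this) j (Finset.mem_univ j)
    rw [this, mem_support_iff] at ha
    apply ha
    have h5 : eval (0 : Fin n → ℂ) f = constantCoeff f := by
      rw [MvPolynomial.eval_zero]
    rw [← constantCoeff_eq, ← h5]
    exact h0
  · intro a _ ha
    rw [notMem_support_iff.1 ha, zero_mul]

lemma factor {ι : Type} [Fintype ι] [DecidableEq ι] {A : Matrix ι ι ℂ} (hA : A.PosSemidef) :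
    ∃ B : Matrix ι ι ℂ, A = Bᴴ * B := by
  obtain ⟨X, hX, -, h⟩ := CFC.exists_sqrt_of_isSelfAdjoint_of_quasispectrumRestricts
    hA.isHermitian (QuasispectrumRestricts.nnreal_of_nonneg hA.nonneg)
  exact ⟨X, by rw [← h]; congr 1; exact hX.star_eq.symm⟩

/-- the set of the theorem -/
def SS (n d : ℕ) : Set ((Metric.ball (0 : EuclideanSpace ℂ (Fin n)) 1) → ℝ) :=
  {F | ∃ (N : ℕ) (f : Fin N → MvPolynomial (Fin n) ℂ),
      (∀ i, (f i).totalDegree ≤ d) ∧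
      (∀ i, eval (fun _ : Fin n => (0 : ℂ)) (f i) = 0) ∧
      (∀ z : EuclideanSpace ℂ (Fin n), ‖z‖ = 1 →
        ∑ i, ‖eval (fun j => z j) (f i)‖ ^ 2 = 1) ∧
      F = fun z : Metric.ball (0 : EuclideanSpace ℂ (Fin n)) 1 =>
        ∑ i, ‖eval (fun j => (z : EuclideanSpace ℂ (Fin n)) j) (f i)‖ ^ 2}

lemma SS_elim {n d : ℕ} {F} (hF : F ∈ SS n d) : ∃ A : Matrix (K n d) (K n d) ℂ,
    A.IsHermitian ∧ (∀ z : EuclideanSpace ℂ (Fin n), ‖z‖ = 1 → ev A (fun j => z j) = 1) ∧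
    F = E n d A := by
  obtain ⟨N, f, h1, h2, h3, rfl⟩ := hF
  let B : Matrix (Fin N) (K n d) ℂ :=
    Matrix.of fun i a => coeff (Finsupp.equivFunOnFinite.symm a.1) (f i)
  have hB : ∀ z : Fin n → ℂ, ev (Bᴴ * B) z = ((∑ i, ‖eval z (f i)‖^2 : ℝ) : ℂ) := by
    intro z
    rw [ev_sq]
    congr 1
    refine Finset.sum_congr rfl fun i _ => ?_
    rw [eval_repr (f i) (h1 i) (h2 i)]
    rfl
  refine ⟨Bᴴ * B, isHermitian_conjTranspose_mul_self _, fun z hz => ?_, ?_⟩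
  · rw [hB, h3 z hz]; simp
  · ext z
    change _ = (ev (Bᴴ * B) _).re
    rw [hB, Complex.ofReal_re]

lemma SS_intro {n d : ℕ} {A : Matrix (K n d) (K n d) ℂ} (hA : A.PosSemidef)
    (h : ∀ z : EuclideanSpace ℂ (Fin n), ‖z‖ = 1 → ev A (fun j => z j) = 1) :
    E n d A ∈ SS n d := by
  obtain ⟨B, rfl⟩ := factor hA
  let e := Fintype.equivFin (K n d)
  let f : K n d → MvPolynomial (Fin n) ℂ := fun i =>
    ∑ a, monomial (Finsupp.equivFunOnFinite.symm a.1) (B i a)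
  have hf : ∀ i z, eval z (f i) = ∑ a, B i a * mon z a := by
    intro i z
    simp only [f, map_sum, eval_monomial]
    refine Finset.sum_congr rfl fun a _ => ?_
    rw [Finsupp.prod_fintype _ _ (by simp)]
    rfl
  have hs : ∀ z : Fin n → ℂ,
      ev (Bᴴ * B) z = ((∑ i, ‖eval z (f (e.symm i))‖^2 : ℝ) : ℂ) := by
    intro z
    rw [ev_sq, e.symm.sum_comp (fun i => ‖eval z (f i)‖^2)]
    simp only [hf]
  refine ⟨_, fun i => f (e.symm i), ?_, ?_, ?_, ?_⟩
  · intro i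
    refine totalDegree_finsetSum_le fun a _ => ?_
    refine (totalDegree_monomial_le _ _).trans ?_
    rw [Finsupp.sum_fintype _ _ (by simp)]
    exact (mem_K.1 a.2).2
  · intro i
    rw [hf]
    refine Finset.sum_eq_zero fun a _ => ?_
    have := (mem_K.1 a.2).1
    simp only [mon, Finset.prod_pow_eq_pow_sum]
    rw [zero_pow (by omega), mul_zero]
  · intro z hz
    have := h z hz
    rw [hs] at this
    exact_mod_cast this
  · ext z
    change (ev (Bᴴ * B) _).re = _
    rw [hs, Complex.ofReal_re]

lemma direction_eq (n d : ℕ) (hd : 1 ≤ d) :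
    (affineSpan ℝ (SS n d)).direction = (W n d).map (E n d) := by
  rw [direction_affineSpan]
  apply le_antisymm
  · rw [vectorSpan_def, Submodule.span_le]
    rintro _ ⟨F, hF, G, hG, rfl⟩
    obtain ⟨A, hA, hA1, rfl⟩ := SS_elim hF
    obtain ⟨B, hB, hB1, rfl⟩ := SS_elim hG
    refine ⟨A - B, ⟨hA.sub hB, fun z hz => ?_⟩, ?_⟩
    · rw [ev_sub, hA1 z hz, hB1 z hz, sub_self]
    · rw [map_sub]; rfl
  · rintro _ ⟨A, hA, rfl⟩
    have hdpos : (0:ℝ) < 1 / d := by positivity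
    obtain ⟨ε, hε, hp⟩ := perturb (Dw n d) (1/d) hdpos (Dw_ge n d hd) A hA.1
    set D0 := Matrix.diagonal (fun a => (Dw n d a : ℂ)) with hD0
    have hD : D0.PosSemidef := by
      refine PosSemidef.diagonal fun a => ?_
      have := hdpos.le.trans (Dw_ge n d hd a)
      change (0:ℂ) ≤ (Dw n d a : ℂ)
      exact_mod_cast this
    have h1 := SS_intro hD (ev_Dw n d hd)
    have h2 := SS_intro hp (fun z hz => by
      rw [ev_add, ev_Dw n d hd z hz, ev_rsmul, hA.2 z hz]; simp)
    have h3 := vsub_mem_vectorSpan ℝ h2 h1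
    rw [vsub_eq_sub, ← map_sub, add_sub_cancel_left, map_smul] at h3
    have h4 := Submodule.smul_mem _ ε⁻¹ h3
    rwa [smul_smul, inv_mul_cancel₀ hε.ne', one_smul] at h4

end PPM

/-- The affine span of the set of squared norms of origin-preserving proper
polynomial maps between balls of degree at most `d` has dimension exactly
`δ(n, d-1)²`, where `δ(n,m) = C(n+m,n) - 1` is the dimension of the space of
polynomials in `n` variables of degree at most `m` with zero constant term. -/
theorem dimension_of_family_of_proper_polynomial_maps
    (n d : ℕ) (hn : 1 ≤ n) (hd : 1 ≤ d)
    (S : Set ((Metric.ball (0 : EuclideanSpace ℂ (Fin n)) 1) → ℝ))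
    (hS : S = {F | ∃ (N : ℕ) (f : Fin N → MvPolynomial (Fin n) ℂ),
      (∀ i, (f i).totalDegree ≤ d) ∧
      (∀ i, eval (fun _ : Fin n => (0 : ℂ)) (f i) = 0) ∧
      (∀ z : EuclideanSpace ℂ (Fin n), ‖z‖ = 1 →
        ∑ i, ‖eval (fun j => z j) (f i)‖ ^ 2 = 1) ∧
      F = fun z : Metric.ball (0 : EuclideanSpace ℂ (Fin n)) 1 =>
        ∑ i, ‖eval (fun j => (z : EuclideanSpace ℂ (Fin n)) j) (f i)‖ ^ 2}) :
    FiniteDimensional ℝ (affineSpan ℝ S).direction ∧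
    Module.finrank ℝ (affineSpan ℝ S).direction
      = ((n + (d - 1)).choose n - 1) ^ 2 := by
  obtain ⟨m, rfl⟩ : ∃ m, d = m + 1 := ⟨d - 1, by omega⟩
  have hS' : S = PPM.SS n (m+1) := hS
  rw [hS', PPM.direction_eq n (m+1) hd]
  have : FiniteDimensional ℝ (PPM.W n (m+1)) := inferInstance
  refine ⟨inferInstance, ?_⟩
  let f : PPM.W n (m+1) →ₗ[ℝ] _ := (PPM.E n (m+1)).comp (PPM.W n (m+1)).subtype
  have hf : Function.Injective f := by
    rw [← LinearMap.ker_eq_bot, LinearMap.ker_eq_bot']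
    intro A hA
    ext1
    exact PPM.E_inj A.2.1 hA
  have h1 : (PPM.W n (m+1)).map (PPM.E n (m+1)) = LinearMap.range f := by
    rw [LinearMap.range_comp, Submodule.range_subtype]
  rw [h1, LinearMap.finrank_range_of_inj hf, PPM.finrank_W]
  simp
end
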